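/- arXiv:2303.08497 — 2 statements merged into one kernel-verified Lean document; each statement's English description precedes it below -/
import Mathlib

section
/- Let R be a ring with ℤ ⊆ R ⊆ ℚ, let n ≥ 3 be an integer and d > 0 a divisor of n, and let L_d denote Craig's integral representation of S_n of rank n−1 in which the transposition (k, k+1) acts by the matrix V_d^{−1} F_k V_d for 1 ≤ k ≤ n−1. Then the ring of invariants R[L_d]^{S_n} is isomorphic to a polynomial ring over R if and only if d/n ∈ R, except in the single case n = 4 and d = 2, where ℤ[L_2]^{S_4} is also a polynomial ring. -/
set_option synthInstance.maxHeartbeats 1000000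
set_option maxHeartbeats 1000000

open MvPolynomial

/-- The `(n-1) × (n-1)` rational matrix `E^{i,j}` (1-based indices `i`, `j`) whose
`(i,j)`-entry is `1` and all other entries are `0`; it is the zero matrix when `i` or `j`
is out of the range `1, …, n-1`. -/
def Emat (n i j : ℕ) : Matrix (Fin (n - 1)) (Fin (n - 1)) ℚ :=
  Matrix.of fun a b => if (a : ℕ) + 1 = i ∧ (b : ℕ) + 1 = j then 1 else 0

/-- `F_k = I_{n-1} + E^{n-k-1,n-k} - 2 E^{n-k,n-k} + E^{n-k+1,n-k}`. -/
def Fmat (n k : ℕ) : Matrix (Fin (n - 1)) (Fin (n - 1)) ℚ :=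
  1 + Emat n (n - k - 1) (n - k) - 2 • Emat n (n - k) (n - k) + Emat n (n - k + 1) (n - k)

/-- `V_d = d E^{1,1} + ∑_{i=2}^{n-1} (E^{i,i} + (n-i) E^{1,i})`. -/
def Vmat (n d : ℕ) : Matrix (Fin (n - 1)) (Fin (n - 1)) ℚ :=
  d • Emat n 1 1 + ∑ i ∈ Finset.Icc 2 (n - 1), (Emat n i i + (n - i) • Emat n 1 i)

/-- The image of Craig's representation `L_d` of `S_n`: the subgroup of `GL_{n-1}(ℚ)`
generated by the images `V_d⁻¹ F_k V_d` of the adjacent transpositions `(k, k+1)`. -/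
noncomputable def craigGroup (n d : ℕ) : Subgroup (GL (Fin (n - 1)) ℚ) :=
  Subgroup.closure {g | ∃ k, 1 ≤ k ∧ k ≤ n - 1 ∧
    (g : Matrix (Fin (n - 1)) (Fin (n - 1)) ℚ) = (Vmat n d)⁻¹ * Fmat n k * Vmat n d}

/-- The algebra endomorphism of `ℚ[x_1, …, x_m]` given by the linear substitution
`x_i ↦ ∑_j M_{i,j} x_j` for a matrix `M`. -/
noncomputable def actQ {m : ℕ} (M : Matrix (Fin m) (Fin m) ℚ) :
    MvPolynomial (Fin m) ℚ →ₐ[ℚ] MvPolynomial (Fin m) ℚ :=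
  aeval fun i => ∑ j, C (M i j) * X j

/-- For a subring `R ⊆ ℚ` and a subgroup `G ⊆ GL_m(ℚ)`, the invariant ring `R[x_1, …, x_m]^G`:
the `R`-subalgebra of `ℚ[x_1, …, x_m]` consisting of the polynomials with all coefficients
in `R` that are fixed by the substitution action of every element of `G`. -/
noncomputable def invariantRingQ {m : ℕ} (R : Subring ℚ) (G : Subgroup (GL (Fin m) ℚ)) :
    Subalgebra ↥R (MvPolynomial (Fin m) ℚ) :=
  (MvPolynomial.mapAlgHom (R := ↥R) (σ := Fin m) (Algebra.ofId ↥R ℚ)).range ⊓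
    Subalgebra.restrictScalars ↥R
      (⨅ g ∈ G, AlgHom.equalizer (actQ (g : Matrix (Fin m) (Fin m) ℚ)) (AlgHom.id ℚ _))

/-- `R[x_1, …, x_m]^G` is isomorphic to a polynomial ring over `R`. -/
def IsPolynomialRingQ {m : ℕ} (R : Subring ℚ) (G : Subgroup (GL (Fin m) ℚ)) : Prop :=
  ∃ k : ℕ, Nonempty (↥(invariantRingQ R G) ≃ₐ[↥R] MvPolynomial (Fin k) ↥R)

/-! ### Craig's action in root coordinates -/

section Action

variable (k : Type*) [CommRing k] {m : ℕ} (d q : ℕ)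

/-- The linear form on Craig's lattice `L_d` (of rank `m + 1`) corresponding to `e_i - e_1`, where
`e_0, …, e_{m+1}` are permuted by the symmetric group. -/
noncomputable def rootForm (i : Fin (m + 2)) : MvPolynomial (Fin (m + 1)) k :=
  Fin.cons (α := fun _ => MvPolynomial (Fin (m + 1)) k)
    (C (d : k) * X 0 - ∑ j : Fin (m + 1), Fin.partialSum (fun l : Fin m => -X l.succ) j)
    (Fin.partialSum fun l : Fin m => -X l.succ) i

theorem rootForm_one : rootForm k d (1 : Fin (m + 2)) = 0 := by
  rw [← Fin.succ_zero_eq_one, rootForm, Fin.cons_succ, Fin.partialSum_zero]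

theorem sum_rootForm : ∑ i : Fin (m + 2), rootForm k d i = C (d : k) * X 0 := by
  rw [Fin.sum_univ_succ]
  simp [rootForm]

theorem rootForm_sub_rootForm (l : Fin m) :
    rootForm k d l.castSucc.succ - rootForm k d l.succ.succ = X l.succ := by
  simp [rootForm, Fin.partialSum_succ]

/-- The action of a permutation of `e_0, …, e_{m+1}` on polynomials on Craig's lattice `L_d`, where
`m + 2 = d * q`. -/
noncomputable def craigAct (σ : Equiv.Perm (Fin (m + 2))) :
    MvPolynomial (Fin (m + 1)) k →ₐ[k] MvPolynomial (Fin (m + 1)) k :=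
  aeval (Fin.cons (α := fun _ => MvPolynomial (Fin (m + 1)) k)
    (X 0 - C (q : k) * rootForm k d (σ 1))
    fun l : Fin m => rootForm k d (σ l.castSucc.succ) - rootForm k d (σ l.succ.succ))

variable (σ τ : Equiv.Perm (Fin (m + 2)))

theorem craigAct_X_zero :
    craigAct k d q σ (X 0) = X 0 - C (q : k) * rootForm k d (σ 1) := by
  simp [craigAct]

theorem craigAct_X_succ (l : Fin m) : craigAct k d q σ (X l.succ) =
    rootForm k d (σ l.castSucc.succ) - rootForm k d (σ l.succ.succ) := by
  simp [craigAct]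

variable {d q}

theorem craigAct_rootForm (hdq : d * q = m + 2) (i : Fin (m + 2)) :
    craigAct k d q σ (rootForm k d i) = rootForm k d (σ i) - rootForm k d (σ 1) := by
  have hsucc (j : Fin (m + 1)) : craigAct k d q σ (rootForm k d j.succ) =
      rootForm k d (σ j.succ) - rootForm k d (σ 1) := by
    induction j using Fin.induction with
    | zero => simp [rootForm_one]
    | succ l ih =>
      have h := congrArg (craigAct k d q σ) (rootForm_sub_rootForm k d l)
      rw [map_sub, craigAct_X_succ, ih] at h
      linear_combination -h
  induction i using Fin.cases with
  | succ j => exact hsucc j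
  | zero =>
    have h := congrArg (craigAct k d q σ) (sum_rootForm k d (m := m))
    have h' : ∑ i, rootForm k d (σ i) = _ := (Equiv.sum_comp σ _).trans (sum_rootForm k d)
    rw [Fin.sum_univ_succ, map_add, map_sum, Finset.sum_congr rfl fun j _ => hsucc j,
      Finset.sum_sub_distrib, map_mul, algHom_C, craigAct_X_zero] at h
    rw [Fin.sum_univ_succ] at h'
    have hC : (d : MvPolynomial (Fin (m + 1)) k) * q = m + 2 := mod_cast congrArg Nat.cast hdq
    simp only [Finset.sum_const, Finset.card_univ, Fintype.card_fin, nsmul_eq_mul,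
      algebraMap_eq, map_natCast] at h h'
    push_cast at h
    linear_combination h - h' - hC * rootForm k d (σ 1)

theorem craigAct_comp (hdq : d * q = m + 2) :
    (craigAct k d q σ).comp (craigAct k d q τ) = craigAct k d q (σ * τ) := by
  refine algHom_ext fun j => ?_
  induction j using Fin.cases with
  | zero =>
    simp only [AlgHom.comp_apply, craigAct_X_zero, map_sub, map_mul, craigAct_rootForm _ _ hdq,
      algHom_C, Equiv.Perm.mul_apply, algebraMap_eq]
    ring
  | succ l =>
    simp only [AlgHom.comp_apply, craigAct_X_succ, map_sub, craigAct_rootForm _ _ hdq,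
      Equiv.Perm.mul_apply]
    ring

theorem craigAct_craigAct (hdq : d * q = m + 2) (f : MvPolynomial (Fin (m + 1)) k) :
    craigAct k d q σ (craigAct k d q τ f) = craigAct k d q (σ * τ) f :=
  DFunLike.congr_fun (craigAct_comp k σ τ hdq) f

theorem craigAct_one : craigAct k d q (1 : Equiv.Perm (Fin (m + 2))) =
    AlgHom.id k _ := by
  refine algHom_ext fun j => ?_
  induction j using Fin.cases with
  | zero => simp [craigAct_X_zero, rootForm_one]
  | succ l => simp only [craigAct_X_succ, Equiv.Perm.one_apply, rootForm_sub_rootForm,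
      AlgHom.id_apply]

variable (d q) {k} {k' : Type*} [CommRing k'] (f : k →+* k')

theorem map_rootForm (i : Fin (m + 2)) : map f (rootForm k d i) = rootForm k' d i := by
  have hsucc (j : Fin (m + 1)) : map f (rootForm k d j.succ) = rootForm k' d j.succ := by
    induction j using Fin.induction with
    | zero => simp [rootForm_one]
    | succ l ih =>
      have h := congrArg (map f) (rootForm_sub_rootForm k d l)
      rw [map_sub, ih, map_X, ← rootForm_sub_rootForm k' d l] at h
      linear_combination -h
  induction i using Fin.cases with
  | succ j => exact hsucc j
  | zero =>
    have h := congrArg (map f) (sum_rootForm k d (m := m))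
    have h' := sum_rootForm k' d (m := m)
    rw [Fin.sum_univ_succ] at h h'
    rw [map_add, map_sum, Finset.sum_congr rfl fun j _ => hsucc j] at h
    simp only [map_mul, map_X, map_natCast] at h h'
    linear_combination h - h'

theorem map_craigAct (p : MvPolynomial (Fin (m + 1)) k) :
    map f (craigAct k d q σ p) = craigAct k' d q σ (map f p) := by
  induction p using MvPolynomial.induction_on with
  | C a => simp only [algHom_C, algebraMap_eq, map_C]
  | add p p' hp hp' => simp only [map_add, hp, hp']
  | mul_X p j hp =>
    rw [map_mul, map_mul, map_mul, map_mul, hp]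
    congr 1
    induction j using Fin.cases with
    | zero => simp [craigAct_X_zero, map_rootForm]
    | succ l => simp [craigAct_X_succ, map_rootForm]

variable (k) (m)

/-- The invariants of the symmetric group in the polynomial ring on `L_d` over `k`. -/
noncomputable def craigInvariants : Subalgebra k (MvPolynomial (Fin (m + 1)) k) :=
  ⨅ σ, AlgHom.equalizer (craigAct k d q σ) (AlgHom.id k _)

variable {k m d q}

theorem mem_craigInvariants {p : MvPolynomial (Fin (m + 1)) k} :
    p ∈ craigInvariants k m d q ↔ ∀ σ, craigAct k d q σ p = p := by
  simp [craigInvariants, Algebra.mem_iInf, AlgHom.mem_equalizer]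

theorem sum_craigAct_mem (hdq : d * q = m + 2) (p : MvPolynomial (Fin (m + 1)) k) :
    ∑ σ, craigAct k d q σ p ∈ craigInvariants k m d q := by
  refine mem_craigInvariants.2 fun τ => ?_
  simp only [map_sum, craigAct_craigAct k _ _ hdq]
  exact Equiv.sum_comp (Equiv.mulLeft τ) fun σ => craigAct k d q σ p

theorem prod_craigAct_mem (hdq : d * q = m + 2) (p : MvPolynomial (Fin (m + 1)) k) :
    ∏ σ, craigAct k d q σ p ∈ craigInvariants k m d q := by
  refine mem_craigInvariants.2 fun τ => ?_
  simp only [map_prod, craigAct_craigAct k _ _ hdq]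
  exact Equiv.prod_comp (Equiv.mulLeft τ) fun σ => craigAct k d q σ p

end Action

section Matrix

variable {m : ℕ}

theorem actQ_X {r : ℕ} (M : Matrix (Fin r) (Fin r) ℚ) (i : Fin r) :
    actQ M (X i) = ∑ j, C (M i j) * X j := by
  simp [actQ]

theorem actQ_comp {r : ℕ} (M N : Matrix (Fin r) (Fin r) ℚ) :
    (actQ M).comp (actQ N) = actQ (N * M) := by
  refine algHom_ext fun i => ?_
  simp only [AlgHom.comp_apply, actQ_X, map_sum, map_mul, algHom_C, algebraMap_eq,
    Matrix.mul_apply, Finset.mul_sum, Finset.sum_mul, mul_assoc]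
  exact Finset.sum_comm

theorem actQ_one {r : ℕ} : actQ (1 : Matrix (Fin r) (Fin r) ℚ) = AlgHom.id ℚ _ := by
  refine algHom_ext fun i => ?_
  simp [actQ_X, Matrix.one_apply, Finset.sum_ite_eq]

theorem actQ_injective {r : ℕ} :
    Function.Injective (actQ : Matrix (Fin r) (Fin r) ℚ → _) := by
  intro M N h
  ext i j
  have := congrArg (coeff (Finsupp.single j 1)) (DFunLike.congr_fun h (X i))
  simpa [actQ_X, coeff_sum, coeff_C_mul, coeff_X, Finsupp.single_left_inj] using this

/-- The matrix `V_d` for `S_{m+2}`. -/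
noncomputable def craigV (m d : ℕ) : Matrix (Fin (m + 1)) (Fin (m + 1)) ℚ := Vmat (m + 2) d

/-- The matrix `F_k` for `S_{m+2}`, where `k = m + 1 - a`. -/
noncomputable def craigF (m : ℕ) (a : Fin (m + 1)) : Matrix (Fin (m + 1)) (Fin (m + 1)) ℚ :=
  Fmat (m + 2) (m + 1 - a)

theorem Emat_apply (n i j : ℕ) (a b : Fin (n - 1)) :
    Emat n i j a b = if (a : ℕ) + 1 = i ∧ (b : ℕ) + 1 = j then 1 else 0 := rfl

theorem craigV_apply (d : ℕ) (i j : Fin (m + 1)) : craigV m d i j =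
    d * (if (i : ℕ) + 1 = 1 ∧ (j : ℕ) + 1 = 1 then 1 else 0) + ∑ x ∈ Finset.Icc 2 (m + 1),
      ((if (i : ℕ) + 1 = x ∧ (j : ℕ) + 1 = x then 1 else 0) +
        ((m + 2 - x : ℕ) : ℚ) * if (i : ℕ) + 1 = 1 ∧ (j : ℕ) + 1 = x then 1 else 0) := by
  rw [craigV, Vmat, Matrix.add_apply, Matrix.sum_apply]
  simp only [Matrix.add_apply, Matrix.smul_apply]
  simp only [Emat_apply, nsmul_eq_mul]
  rfl

theorem craigV_zero_zero (d : ℕ) : craigV m d 0 0 = d := by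
  rw [craigV_apply, Finset.sum_eq_zero]
  · simp
  · intro x hx
    have := (Finset.mem_Icc.1 hx).1
    rw [if_neg (by simp; lia), if_neg (by simp; lia)]
    simp

theorem craigV_zero_succ (d : ℕ) (l : Fin m) : craigV m d 0 l.succ = ((m - l : ℕ) : ℚ) := by
  rw [craigV_apply, Finset.sum_eq_single ((l : ℕ) + 2)]
  · simp
  · intro x hx hne
    rw [if_neg (by simp; lia), if_neg (by simp; lia)]
    simp
  · simp

theorem craigV_succ (d : ℕ) (l : Fin m) (j : Fin (m + 1)) :
    craigV m d l.succ j = if l.succ = j then 1 else 0 := by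
  rw [craigV_apply, Finset.sum_eq_single ((l : ℕ) + 2)]
  · simp [Fin.ext_iff, eq_comm (a := (j : ℕ))]
  · intro x hx hne
    rw [if_neg (by simp; lia), if_neg (by simp)]
    simp
  · simp

theorem det_craigV (d : ℕ) : (craigV m d).det = d := by
  rw [Matrix.det_of_isUpperTriangular]
  · simp [Fin.prod_univ_succ, craigV_zero_zero, craigV_succ]
  · intro i j hij
    induction i using Fin.cases with
    | zero => simp at hij
    | succ l => rw [craigV_succ, if_neg]; exact (ne_of_gt hij)

theorem sum_partialSum {M : Type*} [AddCommMonoid M] (f : Fin m → M) :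
    ∑ j, Fin.partialSum f j = ∑ l : Fin m, (m - l : ℕ) • f l := by
  induction m with
  | zero => simp
  | succ m ih =>
    have h (j : Fin (m + 1)) : Fin.partialSum f j.castSucc = Fin.partialSum (Fin.init f) j := by
      induction j using Fin.induction with
      | zero => simp
      | succ l ihl =>
        rw [← Fin.succ_castSucc, Fin.partialSum_succ, ihl, Fin.partialSum_succ]; rfl
    have hl : Fin.partialSum f (Fin.last (m + 1)) = ∑ l, f l := by
      simp [Fin.partialSum, List.take_of_length_le, List.sum_ofFn, Fin.sum_univ_succ]
    rw [Fin.sum_univ_castSucc, Finset.sum_congr rfl fun j _ => h j, ih, hl,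
      Fin.sum_univ_castSucc (fun l => f l), Fin.sum_univ_castSucc, ← add_assoc,
      ← Finset.sum_add_distrib]
    congr 1
    · refine Finset.sum_congr rfl fun l _ => ?_
      rw [Fin.val_castSucc, Nat.succ_sub l.2.le, succ_nsmul]; rfl
    · simp

theorem actQ_craigV_X (d : ℕ) (i : Fin (m + 1)) :
    actQ (craigV m d) (X i) = rootForm ℚ d i.castSucc - rootForm ℚ d i.succ := by
  rw [actQ_X]
  induction i using Fin.cases with
  | zero =>
    rw [Fin.sum_univ_succ, Fin.succ_zero_eq_one, rootForm_one, Fin.castSucc_zero, rootForm,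
      Fin.cons_zero, sum_partialSum]
    simp [craigV_zero_zero, craigV_zero_succ]
  | succ l =>
    rw [← Fin.succ_castSucc, rootForm_sub_rootForm, Finset.sum_eq_single l.succ]
    · simp [craigV_succ]
    · intro j _ hj
      simp [craigV_succ, hj.symm]
    · simp

theorem craigF_apply (a i j : Fin (m + 1)) : craigF m a i j =
    (if i = j then 1 else 0) + if j = a then
      (if (i : ℕ) + 1 = a then 1 else 0) - (if i = a then 2 else 0) +
      (if (i : ℕ) = a + 1 then 1 else 0) else 0 := by
  have h : m + 2 - (m + 1 - a) = (a : ℕ) + 1 := by lia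
  rw [craigF, Fmat]
  simp only [Matrix.add_apply, Matrix.sub_apply, Matrix.smul_apply]
  simp only [Emat_apply, nsmul_eq_mul, h, Matrix.one_apply, Fin.ext_iff]
  by_cases hj : (j : ℕ) = a
  · simp [hj]
    ring
  · simp [hj]

theorem actQ_craigF_X (a i : Fin (m + 1)) : actQ (craigF m a) (X i) =
    X i + C ((if (i : ℕ) + 1 = a then 1 else 0) - (if i = a then 2 else 0) +
      (if (i : ℕ) = a + 1 then 1 else 0)) * X a := by
  simp only [actQ_X, craigF_apply, C_add, add_mul, Finset.sum_add_distrib]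
  congr 1
  · rw [Finset.sum_eq_single i] <;> simp +contextual [eq_comm]
  · rw [Finset.sum_eq_single a] <;> simp +contextual [add_mul]

theorem actQ_generator {d q : ℕ} (hd : 0 < d) (hdq : d * q = m + 2) (a : Fin (m + 1)) :
    actQ ((craigV m d)⁻¹ * craigF m a * craigV m d) =
      craigAct ℚ d q (Equiv.swap a.castSucc a.succ) := by
  have hcomm : (actQ (craigV m d)).comp (actQ (craigF m a)) =
      (craigAct ℚ d q (Equiv.swap a.castSucc a.succ)).comp (actQ (craigV m d)) := by
    refine algHom_ext fun i => ?_
    simp only [AlgHom.comp_apply, actQ_craigF_X, map_add, map_mul, algHom_C, algebraMap_eq,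
      actQ_craigV_X, map_sub, craigAct_rootForm _ _ hdq]
    have hne (b : Fin (m + 2)) (h1 : (b : ℕ) ≠ a) (h2 : (b : ℕ) ≠ a + 1) :
        Equiv.swap a.castSucc a.succ b = b :=
      Equiv.swap_apply_of_ne_of_ne (by simpa [Fin.ext_iff] using h1)
        (by simpa [Fin.ext_iff] using h2)
    by_cases h1 : i = a
    · subst h1
      simp [Equiv.swap_apply_left, Equiv.swap_apply_right, map_ofNat C 2]
      ring
    have h1' : (i : ℕ) ≠ a := fun h => h1 (Fin.ext h)
    by_cases h2 : (i : ℕ) + 1 = a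
    · have : i.succ = a.castSucc := Fin.ext (by simpa using h2)
      rw [hne i.castSucc (by simp; lia) (by simp; lia), this, Equiv.swap_apply_left]
      simp [h1, h2, show (i : ℕ) ≠ a + 1 by lia]
    by_cases h3 : (i : ℕ) = a + 1
    · have : i.castSucc = a.succ := Fin.ext (by simpa using h3)
      rw [hne i.succ (by simp; lia) (by simp; lia), this, Equiv.swap_apply_right]
      simp [h1, h3, show (a : ℕ) + 1 + 1 ≠ a by lia]
    rw [hne i.succ (by simp; lia) (by simp; lia), hne i.castSucc (by simp; lia) (by simp; lia)]
    simp [h1, h2, h3]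
  have hu : IsUnit (craigV m d).det := by
    rw [det_craigV]; exact (Nat.cast_ne_zero.2 hd.ne').isUnit
  rw [← actQ_comp, ← actQ_comp, ← AlgHom.comp_assoc, hcomm, AlgHom.comp_assoc, actQ_comp,
    Matrix.nonsing_inv_mul _ hu, actQ_one, AlgHom.comp_id]

/-- The image of Craig's representation of `S_{m+2}`. -/
noncomputable def craigGL (m d : ℕ) : Subgroup (GL (Fin (m + 1)) ℚ) := craigGroup (m + 2) d

theorem craigGL_eq_closure (m d : ℕ) : craigGL m d = Subgroup.closure {g : GL (Fin (m + 1)) ℚ | ∃ a,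
    (g : Matrix (Fin (m + 1)) (Fin (m + 1)) ℚ) = (craigV m d)⁻¹ * craigF m a * craigV m d} := by
  rw [craigGL, craigGroup]
  refine congrArg Subgroup.closure (Set.ext fun g => ⟨?_, ?_⟩)
  · rintro ⟨k, hk1, hk, hg⟩
    refine ⟨⟨m + 1 - k, by lia⟩, ?_⟩
    rw [craigF, Fin.val_mk, show m + 1 - (m + 1 - k) = k by lia]
    exact hg
  · rintro ⟨a, hg⟩
    exact ⟨m + 1 - a, by lia, by lia, hg⟩

theorem exists_mem_craigGL {d q : ℕ} (hd : 0 < d) (hdq : d * q = m + 2) (a : Fin (m + 1)) :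
    ∃ g ∈ craigGL m d, actQ (g : Matrix (Fin (m + 1)) (Fin (m + 1)) ℚ) =
      craigAct ℚ d q (Equiv.swap a.castSucc a.succ) := by
  set M := (craigV m d)⁻¹ * craigF m a * craigV m d with hM
  have hsq : M * M = 1 := by
    apply actQ_injective
    rw [← actQ_comp, actQ_generator hd hdq, craigAct_comp _ _ _ hdq, Equiv.swap_mul_self,
      craigAct_one, actQ_one]
  refine ⟨⟨M, M, hsq, hsq⟩, ?_, actQ_generator hd hdq a⟩
  rw [craigGL_eq_closure]
  exact Subgroup.subset_closure ⟨a, rfl⟩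

theorem iInf_equalizer_craigGL {d q : ℕ} (hd : 0 < d) (hdq : d * q = m + 2) :
    (⨅ g ∈ craigGL m d, AlgHom.equalizer (actQ (g : Matrix (Fin (m + 1)) (Fin (m + 1)) ℚ))
      (AlgHom.id ℚ _)) = craigInvariants ℚ m d q := by
  ext f
  simp only [Algebra.mem_iInf, AlgHom.mem_equalizer, AlgHom.id_apply, mem_craigInvariants]
  constructor
  · intro h σ
    have hσ : σ ∈ Submonoid.closure
        (Set.range fun a : Fin (m + 1) => Equiv.swap a.castSucc a.succ) := by
      rw [Equiv.Perm.mclosure_swap_castSucc_succ]; trivial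
    induction hσ using Submonoid.closure_induction with
    | mem σ hσ =>
      obtain ⟨a, rfl⟩ := hσ
      obtain ⟨g, hg, hga⟩ := exists_mem_craigGL hd hdq a
      rw [← hga]
      exact h g hg
    | one => rw [craigAct_one]; rfl
    | mul σ τ _ _ hσ hτ => rw [← craigAct_craigAct ℚ σ τ hdq, hτ, hσ]
  · intro h g hg
    rw [craigGL_eq_closure] at hg
    have hmul (g g' : GL (Fin (m + 1)) ℚ) :
        actQ ((g * g' : GL (Fin (m + 1)) ℚ) : Matrix (Fin (m + 1)) (Fin (m + 1)) ℚ) f =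
          actQ (g' : Matrix (Fin (m + 1)) (Fin (m + 1)) ℚ)
            (actQ (g : Matrix (Fin (m + 1)) (Fin (m + 1)) ℚ) f) := by
      rw [Units.val_mul, ← actQ_comp, AlgHom.comp_apply]
    have hone : actQ ((1 : GL (Fin (m + 1)) ℚ) : Matrix (Fin (m + 1)) (Fin (m + 1)) ℚ) f = f := by
      rw [Units.val_one, actQ_one, AlgHom.id_apply]
    induction hg using Subgroup.closure_induction with
    | mem g hg =>
      obtain ⟨a, hg⟩ := hg
      rw [hg, actQ_generator hd hdq, h]
    | one => exact hone
    | mul g g' _ _ hg hg' => rw [hmul, hg, hg']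
    | inv g _ hg =>
      have := hmul g g⁻¹
      rwa [mul_inv_cancel, hone, hg, eq_comm] at this

theorem isPolynomialRingQ_craigGL_iff {d q : ℕ} (hd : 0 < d) (hdq : d * q = m + 2)
    (R : Subring ℚ) : IsPolynomialRingQ R (craigGL m d) ↔
      ∃ k : ℕ, Nonempty (craigInvariants R m d q ≃ₐ[R] MvPolynomial (Fin k) R) := by
  have hmap (p : MvPolynomial (Fin (m + 1)) R) :
      mapAlgHom (R := R) (σ := Fin (m + 1)) (Algebra.ofId R ℚ) p = map R.subtype p := rfl
  have hinj : Function.Injective (mapAlgHom (R := R) (σ := Fin (m + 1)) (Algebra.ofId R ℚ)) :=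
    map_injective R.subtype Subtype.val_injective
  have h : invariantRingQ R (craigGL m d) =
      (craigInvariants R m d q).map (mapAlgHom (R := R) (Algebra.ofId R ℚ)) := by
    rw [invariantRingQ]
    refine (congrArg (fun S => _ ⊓ Subalgebra.restrictScalars R S)
      (iInf_equalizer_craigGL hd hdq)).trans ?_
    ext f
    simp only [Algebra.mem_inf, AlgHom.mem_range, Subalgebra.mem_map,
      Subalgebra.mem_restrictScalars, mem_craigInvariants]
    constructor
    · rintro ⟨⟨p, rfl⟩, hp⟩
      refine ⟨p, fun σ => hinj ?_, rfl⟩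
      rw [hmap, map_craigAct]
      exact hp σ
    · rintro ⟨p, hp, rfl⟩
      refine ⟨⟨p, rfl⟩, fun σ => ?_⟩
      rw [hmap, ← map_craigAct, hp]
  rw [IsPolynomialRingQ, h]
  let e := Subalgebra.equivMapOfInjective (craigInvariants R m d q) _ hinj
  exact ⟨fun ⟨k, ⟨i⟩⟩ => ⟨k, ⟨e.trans i⟩⟩, fun ⟨k, ⟨i⟩⟩ => ⟨k, ⟨e.symm.trans i⟩⟩⟩

end Matrix

section RationalSubring

variable {R : Subring ℚ}

theorem Subring.inv_den_mem {x : ℚ} (hx : x ∈ R) : (x.den : ℚ)⁻¹ ∈ R := by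
  obtain ⟨u, v, h⟩ : IsCoprime x.num x.den := Int.isCoprime_iff_gcd_eq_one.2 x.reduced
  have h' : (u * x.num + v * x.den : ℚ) = 1 := by exact_mod_cast h
  have hne : (x.den : ℚ) ≠ 0 := mod_cast x.den_ne_zero
  have : (x.den : ℚ)⁻¹ = u * x + v := by
    nth_rw 2 [← Rat.num_div_den x]
    field_simp
    linarith
  rw [this]
  exact R.add_mem (R.mul_mem (intCast_mem R u) hx) (intCast_mem R v)

theorem Subring.exists_prime_inv_notMem {q : ℕ} (h0 : q ≠ 0) (hq : (q : ℚ)⁻¹ ∉ R) :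
    ∃ p : ℕ, p.Prime ∧ p ∣ q ∧ (p : ℚ)⁻¹ ∉ R := by
  contrapose! hq
  induction q using induction_on_primes with
  | zero => exact absurd rfl h0
  | one => simp
  | prime_mul p a hp ih =>
    rw [Nat.cast_mul, mul_inv]
    refine R.mul_mem (hq p hp (dvd_mul_right p a)) (ih (right_ne_zero_of_mul h0) ?_)
    exact fun p' hp' h => hq p' hp' (h.mul_left p)

theorem Subring.isMaximal_span_prime {p : ℕ} (hp : p.Prime) (h : (p : ℚ)⁻¹ ∉ R) :
    (Ideal.span {(p : R)}).IsMaximal := by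
  have hp0 : (p : ℚ) ≠ 0 := mod_cast hp.ne_zero
  refine Ideal.isMaximal_iff.2 ⟨fun h1 => ?_, fun J x hJ hx hxJ => ?_⟩
  · obtain ⟨y, hy⟩ := Ideal.mem_span_singleton'.1 h1
    have hy' : (y : ℚ) * p = 1 := congrArg Subtype.val hy
    exact h (eq_inv_of_mul_eq_one_left hy' ▸ y.2)
  · have hpx : ¬ (p : ℤ) ∣ (x : ℚ).num := by
      rintro ⟨a, ha⟩
      refine hx (Ideal.mem_span_singleton'.2
        ⟨⟨a * ((x : ℚ).den : ℚ)⁻¹, R.mul_mem (intCast_mem R a) (Subring.inv_den_mem x.2)⟩,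
          Subtype.ext ?_⟩)
      change (a : ℚ) * ((x : ℚ).den : ℚ)⁻¹ * p = x
      conv_rhs => rw [← Rat.num_div_den (x : ℚ), ha]
      push_cast
      ring
    obtain ⟨u, v, huv⟩ := ((Nat.prime_iff_prime_int.1 hp).coprime_iff_not_dvd).2 hpx
    have hnum : (((x : ℚ).num : ℤ) : R) = ((x : ℚ).den : R) * x :=
      Subtype.ext (by push_cast; exact (Rat.den_mul_eq_num _).symm)
    have hpJ : (p : R) ∈ J := hJ (Ideal.mem_span_singleton_self _)
    have h1 : (1 : R) = u * p + v * ((x : ℚ).den * x) := by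
      rw [← hnum]; exact_mod_cast congrArg (Int.cast : ℤ → R) huv.symm
    rw [h1]
    exact J.add_mem (J.mul_mem_left _ hpJ) (J.mul_mem_left _ (J.mul_mem_left _ hxJ))

end RationalSubring

section Faithful

variable {K : Type*} [Field K] {m d q : ℕ}

theorem exists_eval_rootForm (hdq : d * q = m + 2) (hq : (q : K) = 0) (v : Fin (m + 2) → K) (t : K)
    (hv : ∑ i, v i = d * t) : ∃ x, ∀ i, eval x (rootForm K d i) = v i - v 1 := by
  let x : Fin (m + 1) → K := Fin.cons (α := fun _ => K) t
    fun l : Fin m => v l.castSucc.succ - v l.succ.succ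
  have hsucc (j : Fin (m + 1)) : eval x (rootForm K d j.succ) = v j.succ - v 1 := by
    induction j using Fin.induction with
    | zero => simp [rootForm_one]
    | succ l ih =>
      have h := congrArg (eval x) (rootForm_sub_rootForm K d l)
      rw [map_sub, ih, eval_X, show x l.succ = _ from Fin.cons_succ _ _ _] at h
      linear_combination -h
  refine ⟨x, fun i => ?_⟩
  induction i using Fin.cases with
  | succ j => exact hsucc j
  | zero =>
    have h := congrArg (eval x) (sum_rootForm K d (m := m))
    have hn : (m : K) + 2 = 0 := by
      rw [← Nat.cast_ofNat, ← Nat.cast_add, ← hdq, Nat.cast_mul, hq, mul_zero]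
    rw [Fin.sum_univ_succ, map_add, map_sum, Finset.sum_congr rfl fun j _ => hsucc j,
      Finset.sum_sub_distrib, map_mul, eval_C, eval_X, show x 0 = t from Fin.cons_zero _ _, ← hv,
      Fin.sum_univ_succ v] at h
    simp only [Finset.sum_const, Finset.card_univ, Fintype.card_fin, nsmul_eq_mul] at h
    push_cast at h
    linear_combination h + hn * v 1

theorem craigAct_injective (hdq : d * q = m + 2) (hq : (q : K) = 0) (hm : 1 ≤ m)
    (h : (d : K) ≠ 0 ∨ 3 ≤ m) : Function.Injective (craigAct K d q (m := m)) := by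
  intro σ τ hστ
  by_contra hne
  obtain ⟨i, hi⟩ : ∃ i, σ i ≠ τ i := by
    by_contra! hall
    exact hne (Equiv.ext hall)
  have hroot (i j) : rootForm K d (σ i) - rootForm K d (σ j) =
      rootForm K d (τ i) - rootForm K d (τ j) := by
    have := DFunLike.congr_fun hστ (rootForm K d i - rootForm K d j)
    simp only [map_sub, craigAct_rootForm _ _ hdq] at this
    linear_combination this
  obtain ⟨j, hj⟩ : ∃ j, j ∉ ({i, σ.symm (τ i)} : Finset (Fin (m + 2))) := by
    by_contra! hall
    have h1 := Finset.card_le_card (fun x _ => hall x : Finset.univ ⊆ _)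
    have h2 := Finset.card_le_two (a := i) (b := σ.symm (τ i))
    rw [Finset.card_univ, Fintype.card_fin] at h1
    lia
  simp only [Finset.mem_insert, Finset.mem_singleton, not_or] at hj
  have hσj : σ j ≠ τ i := fun h => hj.2 (by rw [← h, Equiv.symm_apply_apply])
  have hτj : τ j ≠ τ i := fun h => hj.1 (τ.injective h)
  have key (v : Fin (m + 2) → K) (t : K) (hv : ∑ i, v i = d * t) :
      v (σ i) - v (σ j) = v (τ i) - v (τ j) := by
    obtain ⟨x, hx⟩ := exists_eval_rootForm hdq hq v t hv
    have := congrArg (eval x) (hroot i j)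
    simp only [map_sub, hx] at this
    linear_combination this
  rcases h with hd | hm3
  · have := key (Pi.single (τ i) 1) (d : K)⁻¹ (by
      rw [mul_inv_cancel₀ hd, Finset.sum_pi_single']; simp)
    simp [hi, hσj, hτj] at this
  · obtain ⟨f, hf⟩ : ∃ f, f ∉ ({σ i, σ j, τ i, τ j} : Finset (Fin (m + 2))) := by
      by_contra! hall
      have h1 := Finset.card_le_card (fun x _ => hall x : Finset.univ ⊆ _)
      have h2 := Finset.card_le_four (a := σ i) (b := σ j) (c := τ i) (d := τ j)
      rw [Finset.card_univ, Fintype.card_fin] at h1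
      lia
    simp only [Finset.mem_insert, Finset.mem_singleton, not_or] at hf
    have := key (Pi.single (τ i) 1 - Pi.single f 1) 0 (by
      simp [Finset.sum_sub_distrib, Finset.sum_pi_single'])
    simp [hi, hσj, hτj, Ne.symm hf.1, Ne.symm hf.2.1, Ne.symm hf.2.2.1,
      Ne.symm hf.2.2.2] at this

end Faithful

section NotPolynomial

theorem exists_sum_ne_zero {ι M L : Type*} [Fintype ι] [Nonempty ι] [Monoid M] [CommRing L]
    [IsDomain L] (φ : ι → M →* L) (hφ : Function.Injective φ) : ∃ x, ∑ i, φ i x ≠ 0 := by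
  by_contra! h
  have hli := (linearIndependent_monoidHom M L).comp φ hφ
  have := Fintype.linearIndependent_iff.1 hli (fun _ => 1) (by ext x; simpa using h x)
  exact one_ne_zero (this (Classical.arbitrary ι))

/-- In a polynomial ring `B` over `K`, `π(y) c = π(x)` forces `c` to lift as soon as a power of `c`
lifts. -/
theorem exists_lift_of_pow {S B A : Type*} [CommRing S] [CommRing B] [IsDomain B]
    [CommRing A] [IsDomain A] [IsIntegrallyClosed A] (θ : S →+* A) (hθ : Function.Surjective θ)
    (π : S →+* B) (hker : RingHom.ker π = RingHom.ker θ) {x y N : S} {c : B} {r : ℕ} (hr : r ≠ 0)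
    (hy : π y ≠ 0) (hx : π x = π y * c) (hN : π N = c ^ r) : ∃ z, π z = c := by
  have h1 : x ^ r - y ^ r * N ∈ RingHom.ker θ := by
    rw [← hker, RingHom.mem_ker]
    simp [hx, hN, mul_pow]
  rw [RingHom.mem_ker, map_sub, sub_eq_zero, map_mul, map_pow, map_pow] at h1
  obtain ⟨w, hw⟩ := (IsIntegrallyClosed.pow_dvd_pow_iff hr).1 ⟨_, h1⟩
  obtain ⟨z, rfl⟩ := hθ w
  have h2 : x - y * z ∈ RingHom.ker π := by
    rw [hker, RingHom.mem_ker, map_sub, map_mul, hw, sub_self]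
  rw [RingHom.mem_ker, map_sub, map_mul, hx, ← mul_sub] at h2
  exact ⟨z, (sub_eq_zero.1 ((mul_eq_zero.1 h2).resolve_left hy)).symm⟩

variable {R : Type*} [CommRing R] {m d q : ℕ}

theorem rootForm_isHomogeneous (i : Fin (m + 2)) : (rootForm R d i).IsHomogeneous 1 := by
  have hsucc (j : Fin (m + 1)) : (rootForm R d j.succ).IsHomogeneous 1 := by
    induction j using Fin.induction with
    | zero => simpa [rootForm_one] using isHomogeneous_zero _ _ _
    | succ l ih =>
      rw [show rootForm R d l.succ.succ = rootForm R d l.castSucc.succ - X l.succ by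
        rw [← rootForm_sub_rootForm R d l]; ring]
      exact ih.sub (isHomogeneous_X _ _)
  induction i using Fin.cases with
  | succ j => exact hsucc j
  | zero =>
    have h := sum_rootForm R d (m := m)
    rw [Fin.sum_univ_succ] at h
    rw [eq_sub_of_add_eq h]
    exact ((isHomogeneous_X _ _).C_mul _).sub (IsHomogeneous.sum _ _ _ fun j _ => hsucc j)

theorem IsHomogeneous.craigAct {p : MvPolynomial (Fin (m + 1)) R} {r : ℕ} (hp : p.IsHomogeneous r)
    (σ : Equiv.Perm (Fin (m + 2))) : (craigAct R d q σ p).IsHomogeneous r := by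
  rw [← one_mul r]
  refine hp.aeval _ fun j => ?_
  induction j using Fin.cases with
  | zero => exact (isHomogeneous_X _ _).sub ((rootForm_isHomogeneous _).C_mul _)
  | succ l => exact (rootForm_isHomogeneous _).sub (rootForm_isHomogeneous _)

theorem homogeneousComponent_craigAct (p : MvPolynomial (Fin (m + 1)) R) (r : ℕ)
    (σ : Equiv.Perm (Fin (m + 2))) : homogeneousComponent r (craigAct R d q σ p) =
      craigAct R d q σ (homogeneousComponent r p) := by
  conv_lhs => rw [← sum_homogeneousComponent p, map_sum, map_sum]
  by_cases hr : r ∈ Finset.range (p.totalDegree + 1)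
  · rw [Finset.sum_eq_single_of_mem r hr]
    · exact homogeneousComponent_of_mem
        (IsHomogeneous.craigAct (homogeneousComponent_isHomogeneous r p) σ) |>.trans (if_pos rfl)
    · intro s _ hs
      exact homogeneousComponent_of_mem
        (IsHomogeneous.craigAct (homogeneousComponent_isHomogeneous s p) σ) |>.trans
        (if_neg hs.symm)
  · rw [homogeneousComponent_eq_zero r p (by simpa using hr), map_zero]
    refine Finset.sum_eq_zero fun s hs => ?_
    exact homogeneousComponent_of_mem
      (IsHomogeneous.craigAct (homogeneousComponent_isHomogeneous s p) σ) |>.trans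
      (if_neg fun h : r = s => hr (h ▸ hs))

theorem sum_perm_apply {α M : Type*} [Fintype α] [DecidableEq α] [AddCommMonoid M] (f : α → M)
    (a b : α) : ∑ σ : Equiv.Perm α, f (σ a) = ∑ σ : Equiv.Perm α, f (σ b) := by
  rw [← Equiv.sum_comp (Equiv.mulRight (Equiv.swap a b)) fun σ : Equiv.Perm α => f (σ a)]
  simp

theorem sum_craigAct_of_isHomogeneous_one [IsDomain R] [CharZero R] (hdq : d * q = m + 2)
    {p : MvPolynomial (Fin (m + 1)) R} (hp : p.IsHomogeneous 1) : ∑ σ, craigAct R d q σ p = 0 := by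
  have hp' : p ∈ homogeneousSubmodule (Fin (m + 1)) R 1 := hp
  rw [homogeneousSubmodule_one_eq_span_X] at hp'
  clear hp
  induction hp' using Submodule.span_induction with
  | mem _ h =>
    obtain ⟨j, rfl⟩ := h
    induction j using Fin.cases with
    | succ l =>
      simp only [craigAct_X_succ, Finset.sum_sub_distrib]
      rw [sum_perm_apply (rootForm R d) _ l.succ.succ, sub_self]
    | zero =>
      have h : ((m + 2 : ℕ) : MvPolynomial (Fin (m + 1)) R) *
          ∑ σ : Equiv.Perm (Fin (m + 2)), rootForm R d (σ 1) =
          ((Fintype.card (Equiv.Perm (Fin (m + 2))) : ℕ) : MvPolynomial (Fin (m + 1)) R) *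
            (C (d : R) * X 0) := by
        have : ∑ i, ∑ σ : Equiv.Perm (Fin (m + 2)), rootForm R d (σ i) =
            ∑ i : Fin (m + 2), ∑ σ : Equiv.Perm (Fin (m + 2)), rootForm R d (σ 1) :=
          Finset.sum_congr rfl fun i _ => sum_perm_apply _ _ _
        rw [Finset.sum_const, Finset.card_univ, Fintype.card_fin, nsmul_eq_mul] at this
        rw [← this, Finset.sum_comm]
        rw [Finset.sum_congr rfl fun (σ : Equiv.Perm (Fin (m + 2))) _ =>
          (Equiv.sum_comp σ _).trans (sum_rootForm R d)]
        simp
      have hd : (d : MvPolynomial (Fin (m + 1)) R) ≠ 0 := by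
        rintro h0
        rw [Nat.cast_eq_zero.1 h0] at hdq
        lia
      refine (mul_eq_zero.1 ?_).resolve_left hd
      simp only [craigAct_X_zero, Finset.sum_sub_distrib, ← Finset.mul_sum, Finset.sum_const,
        Finset.card_univ, nsmul_eq_mul]
      have hn : ((m + 2 : ℕ) : MvPolynomial (Fin (m + 1)) R) = d * q := by rw [← hdq, Nat.cast_mul]
      rw [hn] at h
      simp only [map_natCast] at h ⊢
      linear_combination -h
  | zero => simp
  | add p p' hp hp' h h' => simp only [map_add, Finset.sum_add_distrib, h, h', add_zero]
  | smul a p hp h => simp only [map_smul, ← Finset.smul_sum, h, smul_zero]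

theorem coeff_single_one_of_mem [IsDomain R] [CharZero R] (hdq : d * q = m + 2)
    {p : MvPolynomial (Fin (m + 1)) R} (hp : p ∈ craigInvariants R m d q) (j : Fin (m + 1)) :
    coeff (Finsupp.single j 1) p = 0 := by
  have h := sum_craigAct_of_isHomogeneous_one hdq (homogeneousComponent_isHomogeneous 1 p)
  simp only [← homogeneousComponent_craigAct, mem_craigInvariants.1 hp, Finset.sum_const,
    Finset.card_univ, nsmul_eq_mul] at h
  have h' := (mul_eq_zero.1 h).resolve_left (Nat.cast_ne_zero.2 Fintype.card_ne_zero)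
  have := congrArg (coeff (Finsupp.single j 1)) h'
  rwa [coeff_homogeneousComponent, if_pos (by simp), coeff_zero] at this

/-- If `p` is a non-unit prime of `R` dividing `q`, then the invariant ring is not polynomial, unless
the action modulo `p` is unfaithful. -/
theorem not_nonempty_algEquiv [IsDomain R] [CharZero R] (hdq : d * q = m + 2) (hm : 1 ≤ m) {p : ℕ}
    (hp : p.Prime) (hmax : (Ideal.span {(p : R)}).IsMaximal) (hpq : p ∣ q)
    (h : ¬ p ∣ d ∨ 3 ≤ m) (r : ℕ) :
    ¬ Nonempty (craigInvariants R m d q ≃ₐ[R] MvPolynomial (Fin r) R) := by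
  rintro ⟨e⟩
  let K := R ⧸ Ideal.span {(p : R)}
  let := Ideal.Quotient.field (Ideal.span {(p : R)})
  let f : R →+* K := Ideal.Quotient.mk _
  have hf (a : R) : f a = 0 ↔ (p : R) ∣ a := by
    rw [Ideal.Quotient.eq_zero_iff_mem, Ideal.mem_span_singleton]
  have hpK : (p : K) = 0 := by rw [← map_natCast f, hf]
  have hqK : (q : K) = 0 := by
    obtain ⟨a, rfl⟩ := hpq
    rw [Nat.cast_mul, hpK, zero_mul]
  have hdK : (d : K) ≠ 0 ∨ 3 ≤ m := by
    refine h.imp_left fun hpd hd => ?_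
    obtain ⟨u, v, huv⟩ := Nat.isCoprime_iff_coprime.2 ((hp.coprime_iff_not_dvd).2 hpd)
    have hR : (u : R) * p + v * d = 1 := mod_cast congrArg (Int.cast : ℤ → R) huv
    have h' := congrArg f hR
    rw [map_add, map_mul, map_mul, map_natCast, map_natCast, hd, hpK, mul_zero, mul_zero, add_zero,
      map_one] at h'
    exact zero_ne_one h'
  let S := craigInvariants R m d q
  let π : S →+* MvPolynomial (Fin (m + 1)) K := (map f).comp S.subtype
  let θ : S →+* MvPolynomial (Fin r) K := (map f).comp e.toRingEquiv
  have hθ : Function.Surjective θ :=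
    (map_surjective f Ideal.Quotient.mk_surjective).comp e.surjective
  have hker : RingHom.ker π = RingHom.ker θ := by
    ext s
    have hp0 : (p : MvPolynomial (Fin (m + 1)) R) ≠ 0 := Nat.cast_ne_zero.2 hp.ne_zero
    have h1 : s ∈ RingHom.ker π ↔ (p : S) ∣ s := by
      rw [RingHom.mem_ker]
      change map f (s : MvPolynomial (Fin (m + 1)) R) = 0 ↔ _
      rw [← C_dvd_iff_map_hom_eq_zero f (p : R) hf, map_natCast]
      constructor
      · rintro ⟨t, ht⟩
        refine ⟨⟨t, mem_craigInvariants.2 fun σ => mul_left_cancel₀ hp0 ?_⟩, Subtype.ext ht⟩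
        have h3 := mem_craigInvariants.1 s.2 σ
        rwa [ht, map_mul, map_natCast] at h3
      · rintro ⟨t, rfl⟩
        exact ⟨t, by simp⟩
    have h2 : s ∈ RingHom.ker θ ↔ (p : S) ∣ s := by
      rw [RingHom.mem_ker]
      change map f (e s) = 0 ↔ _
      rw [← C_dvd_iff_map_hom_eq_zero f (p : R) hf, map_natCast, ← map_dvd_iff e, map_natCast]
    rw [h1, h2]
  have hπ (s : S) : π s = map f (s : MvPolynomial (Fin (m + 1)) R) := rfl
  have hX (σ : Equiv.Perm (Fin (m + 2))) : craigAct K d q σ (X 0) = X 0 := by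
    rw [craigAct_X_zero, hqK, C_0, zero_mul, sub_zero]
  let φ (σ : Equiv.Perm (Fin (m + 2))) :
      MvPolynomial (Fin (m + 1)) R →* MvPolynomial (Fin (m + 1)) K :=
    ((map f).comp (craigAct R d q σ).toRingHom : _ →+* _)
  have hφ : Function.Injective φ := by
    intro σ τ hστ
    refine craigAct_injective hdq hqK hm hdK (algHom_ext fun j => ?_)
    have : map f (craigAct R d q σ (X j)) = map f (craigAct R d q τ (X j)) :=
      DFunLike.congr_fun hστ (X j)
    rwa [map_craigAct, map_craigAct, map_X] at this
  obtain ⟨F, hF⟩ := exists_sum_ne_zero φ hφ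
  have hφ' (σ G) : φ σ G = craigAct K d q σ (map f G) := map_craigAct d q σ f G
  obtain ⟨z, hz⟩ := exists_lift_of_pow θ hθ π hker (c := X 0)
    (x := ⟨_, sum_craigAct_mem hdq (F * X 0)⟩) (y := ⟨_, sum_craigAct_mem hdq F⟩)
    (N := ⟨_, prod_craigAct_mem hdq (X 0)⟩) (r := Fintype.card (Equiv.Perm (Fin (m + 2))))
    Fintype.card_ne_zero (by rw [hπ, map_sum]; exact hF)
    (by simp only [hπ, map_sum, Finset.sum_mul, map_craigAct, map_mul, map_X, hX])
    (by simp only [hπ, map_prod, map_craigAct, map_X, hX, Finset.prod_const, Finset.card_univ])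
  have := congrArg (coeff (Finsupp.single 0 1)) hz
  rw [hπ, coeff_map, coeff_single_one_of_mem hdq z.2, map_zero, coeff_X, if_pos rfl] at this
  exact zero_ne_one this

end NotPolynomial

/-! ### The invariants when `n / d` is a unit -/

section Unit

variable (k : Type*) [CommRing k] {m : ℕ} (d : ℕ) (r : k)

/-- The map of the symmetric algebra of the permutation lattice onto that of `L_d`, sending `e_i` to
`e_i - (e_0 + ⋯ + e_{m+1}) / (m + 2)`; here `r` is the inverse of `(m + 2) / d`. -/
noncomputable def permToCraig : MvPolynomial (Fin (m + 2)) k →ₐ[k] MvPolynomial (Fin (m + 1)) k :=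
  aeval fun i => rootForm k d i - C r * X 0

/-- A section of `permToCraig`. -/
noncomputable def craigToPerm (q : ℕ) :
    MvPolynomial (Fin (m + 1)) k →ₐ[k] MvPolynomial (Fin (m + 2)) k :=
  aeval (Fin.cons (α := fun _ => MvPolynomial (Fin (m + 2)) k) (-(C (q : k) * X 1))
    fun l : Fin m => X l.castSucc.succ - X l.succ.succ)

/-- The map `y_j ↦ e_{j+2}`, sending variables to the images of elementary symmetric polynomials. -/
noncomputable def esymmToCraig :
    MvPolynomial (Fin (m + 1)) k →ₐ[k] MvPolynomial (Fin (m + 1)) k :=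
  aeval fun j => permToCraig k d r (esymm (Fin (m + 2)) k (j + 2))

variable {k d r} {q : ℕ}

theorem permToCraig_X (i : Fin (m + 2)) : permToCraig k d r (X i) = rootForm k d i - C r * X 0 :=
  aeval_X _ _

theorem permToCraig_sum_X (hdq : d * q = m + 2) (hr : q * r = 1) :
    permToCraig k d r (∑ i : Fin (m + 2), X i) = 0 := by
  simp only [map_sum, permToCraig_X, Finset.sum_sub_distrib, sum_rootForm, Finset.sum_const,
    Finset.card_univ, Fintype.card_fin, nsmul_eq_mul]
  rw [← map_natCast C, ← hdq, ← mul_assoc, ← C_mul, Nat.cast_mul, mul_assoc, hr, mul_one, sub_self]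

theorem permToCraig_rename (hdq : d * q = m + 2) (hr : q * r = 1) (σ : Equiv.Perm (Fin (m + 2)))
    (f : MvPolynomial (Fin (m + 2)) k) :
    permToCraig k d r (rename σ f) = craigAct k d q σ (permToCraig k d r f) := by
  have hC : (C (q : k) * C r : MvPolynomial (Fin (m + 1)) k) = 1 := by rw [← C_mul, hr, C_1]
  refine DFunLike.congr_fun (algHom_ext (f := (permToCraig k d r).comp (rename σ))
    (g := (craigAct k d q σ).comp (permToCraig k d r)) fun i => ?_) f
  simp only [AlgHom.comp_apply, rename_X, permToCraig_X, map_sub, map_mul, algHom_C, algebraMap_eq,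
    craigAct_rootForm k σ hdq, craigAct_X_zero]
  linear_combination -hC * rootForm k d (σ 1)

theorem permToCraig_craigToPerm (hr : q * r = 1) (p : MvPolynomial (Fin (m + 1)) k) :
    permToCraig k d r (craigToPerm k q p) = p := by
  have hC : (C (q : k) * C r : MvPolynomial (Fin (m + 1)) k) = 1 := by rw [← C_mul, hr, C_1]
  refine DFunLike.congr_fun (algHom_ext (f := (permToCraig k d r).comp (craigToPerm k q))
    (g := AlgHom.id k _) fun j => ?_) p
  induction j using Fin.cases with
  | zero =>
    simp only [craigToPerm, AlgHom.comp_apply, aeval_X, Fin.cons_zero, map_neg, map_mul, algHom_C,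
      algebraMap_eq, permToCraig_X, rootForm_one, AlgHom.id_apply]
    linear_combination hC * X 0
  | succ l =>
    simp only [craigToPerm, AlgHom.comp_apply, aeval_X, Fin.cons_succ, map_sub, permToCraig_X,
      AlgHom.id_apply]
    rw [← rootForm_sub_rootForm k d l]
    ring

theorem craigToPerm_rootForm_succ (j : Fin (m + 1)) :
    craigToPerm k q (rootForm k d j.succ) = X j.succ - X 1 := by
  induction j using Fin.induction with
  | zero => simp [rootForm_one]
  | succ l ih =>
    have h := congrArg (craigToPerm k q) (rootForm_sub_rootForm k d l)
    rw [map_sub, ih, craigToPerm, aeval_X, Fin.cons_succ] at h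
    rw [craigToPerm]
    linear_combination -h

theorem sum_X_dvd_of_permToCraig_eq_zero (hdq : d * q = m + 2) (hr : q * r = 1)
    {f : MvPolynomial (Fin (m + 2)) k} (hf : permToCraig k d r f = 0) :
    ∑ i : Fin (m + 2), X i ∣ f := by
  let I := Ideal.span {∑ i : Fin (m + 2), (X i : MvPolynomial (Fin (m + 2)) k)}
  have hC : (C (q : k) * C r : MvPolynomial (Fin (m + 2)) k) = 1 := by rw [← C_mul, hr, C_1]
  have hsucc (j : Fin (m + 1)) : craigToPerm k q (permToCraig k d r (X j.succ)) = X j.succ := by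
    rw [permToCraig_X, map_sub, craigToPerm_rootForm_succ]
    simp only [craigToPerm, map_mul, algHom_C, aeval_X, Fin.cons_zero, algebraMap_eq]
    linear_combination hC * X 1
  have hzero : craigToPerm k q (permToCraig k d r (X 0)) = X 0 - ∑ i : Fin (m + 2), X i := by
    have h := congrArg (craigToPerm k q) (permToCraig_sum_X (m := m) hdq hr)
    rw [Fin.sum_univ_succ, map_add, map_add, map_sum, map_sum,
      Finset.sum_congr rfl fun j _ => hsucc j, map_zero] at h
    rw [Fin.sum_univ_succ]
    linear_combination h
  have key : (Ideal.Quotient.mkₐ k I).comp ((craigToPerm k q).comp (permToCraig k d r)) =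
      Ideal.Quotient.mkₐ k I := by
    refine algHom_ext fun i => ?_
    induction i using Fin.cases with
    | zero =>
      simp only [AlgHom.comp_apply, hzero, map_sub]
      rw [sub_eq_self, Ideal.Quotient.mkₐ_eq_mk, Ideal.Quotient.eq_zero_iff_mem]
      exact Ideal.subset_span rfl
    | succ j => simp only [AlgHom.comp_apply, hsucc]
  have h := DFunLike.congr_fun key f
  rw [AlgHom.comp_apply, AlgHom.comp_apply, hf, map_zero, map_zero, eq_comm,
    Ideal.Quotient.mkₐ_eq_mk, Ideal.Quotient.eq_zero_iff_mem] at h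
  exact Ideal.mem_span_singleton.1 h

theorem isRegular_sum_X (k : Type*) [CommRing k] (m : ℕ) :
    IsRegular (∑ i : Fin (m + 1), (X i : MvPolynomial (Fin (m + 1)) k)) := by
  have h : finSuccEquiv k m (∑ i, X i) =
      Polynomial.X + Polynomial.C (∑ i, X i) := by
    rw [map_sum, Fin.sum_univ_succ, finSuccEquiv_X_zero]
    simp [finSuccEquiv_X_succ]
  have h' := (Polynomial.monic_X_add_C (∑ i : Fin m, (X i : MvPolynomial (Fin m) k))).isRegular
  rw [← h] at h'
  refine (Commute.isRegular_iff (Commute.all _)).2 fun a b hab => ?_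
  refine (finSuccEquiv k m).injective (h'.left ?_)
  simpa using congrArg (finSuccEquiv k m) hab

theorem permToCraig_aeval_esymm (hdq : d * q = m + 2) (hr : q * r = 1)
    (H : MvPolynomial (Fin (m + 2)) k) :
    permToCraig k d r (aeval (fun i : Fin (m + 2) => esymm (Fin (m + 2)) k (i + 1)) H) =
      esymmToCraig k d r (aeval (Fin.cons (α := fun _ => MvPolynomial (Fin (m + 1)) k) 0 X) H) := by
  refine DFunLike.congr_fun (algHom_ext (f := (permToCraig k d r).comp
      (aeval fun i : Fin (m + 2) => esymm (Fin (m + 2)) k (i + 1)))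
    (g := (esymmToCraig k d r).comp
      (aeval (Fin.cons (α := fun _ => MvPolynomial (Fin (m + 1)) k) 0 X))) fun i => ?_) H
  induction i using Fin.cases with
  | zero =>
    simp only [AlgHom.comp_apply, aeval_X, Fin.cons_zero, map_zero, Fin.val_zero, zero_add,
      esymm_one, permToCraig_sum_X hdq hr]
  | succ j =>
    simp only [AlgHom.comp_apply, aeval_X, Fin.cons_succ, esymmToCraig, Fin.val_succ, add_assoc,
      Nat.reduceAdd]

theorem aeval_esymm_injective (k : Type*) [CommRing k] (n : ℕ) : Function.Injective
    (aeval (R := k) fun i : Fin n => esymm (Fin n) k (i + 1)) := by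
  have h := (esymmAlgHom_fin_bijective (R := k) n).1
  refine fun a b hab => h (Subtype.ext ?_)
  rwa [esymmAlgHom_apply, esymmAlgHom_apply]

theorem exists_aeval_esymm_of_isSymmetric {n : ℕ} {f : MvPolynomial (Fin n) k}
    (hf : f.IsSymmetric) : ∃ H : MvPolynomial (Fin n) k,
      aeval (fun i : Fin n => esymm (Fin n) k (i + 1)) H = f := by
  obtain ⟨H, hH⟩ := (esymmAlgHom_fin_bijective (R := k) n).2 ⟨f, hf⟩
  exact ⟨H, by rw [← esymmAlgHom_apply, hH]⟩

theorem esymmToCraig_injective (hdq : d * q = m + 2) (hr : q * r = 1) :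
    Function.Injective (esymmToCraig (m := m) k d r) := by
  rw [injective_iff_map_eq_zero]
  intro G hG
  let G' : MvPolynomial (Fin (m + 2)) k := rename Fin.succ G
  have hG' : aeval (Fin.cons (α := fun _ => MvPolynomial (Fin (m + 1)) k) 0 X) G' = G := by
    rw [aeval_rename]
    exact (congrArg (fun g => aeval g G) (by ext1; simp)).trans (aeval_X_left_apply G)
  have h0 := permToCraig_aeval_esymm hdq hr G'
  rw [hG', hG] at h0
  obtain ⟨h, hh⟩ := sum_X_dvd_of_permToCraig_eq_zero hdq hr h0
  have hs : h.IsSymmetric := fun σ => by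
    refine (isRegular_sum_X k (m + 1)).left ?_
    have h1 := (esymmAlgHom (Fin (m + 2)) k (m + 2) G').2 σ
    rw [esymmAlgHom_apply, hh, map_mul, map_sum] at h1
    simp only [rename_X] at h1
    rwa [Equiv.sum_comp σ (X : Fin (m + 2) → MvPolynomial (Fin (m + 2)) k)] at h1
  obtain ⟨H, rfl⟩ := exists_aeval_esymm_of_isSymmetric hs
  have h2 : G' = X 0 * H := by
    refine aeval_esymm_injective k (m + 2) ?_
    rw [hh, map_mul, aeval_X, Fin.val_zero, zero_add, esymm_one]
  rw [← hG', h2, map_mul, aeval_X, Fin.cons_zero, zero_mul]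

theorem esymmToCraig_mem (hdq : d * q = m + 2) (hr : q * r = 1) (G : MvPolynomial (Fin (m + 1)) k) :
    esymmToCraig k d r G ∈ craigInvariants k m d q := by
  refine mem_craigInvariants.2 fun σ => ?_
  refine DFunLike.congr_fun (algHom_ext (f := (craigAct k d q σ).comp (esymmToCraig k d r))
    (g := esymmToCraig k d r) fun j => ?_) G
  rw [AlgHom.comp_apply, esymmToCraig, aeval_X, ← permToCraig_rename hdq hr, rename_esymm]

theorem map_permToCraig {k' : Type*} [CommRing k'] (f : k →+* k')
    (p : MvPolynomial (Fin (m + 2)) k) :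
    map f (permToCraig k d r p) = permToCraig k' d (f r) (map f p) := by
  induction p using MvPolynomial.induction_on with
  | C a => simp only [algHom_C, algebraMap_eq, map_C]
  | add p p' hp hp' => simp only [map_add, hp, hp']
  | mul_X p j hp => simp only [map_mul, hp, permToCraig_X, map_X, map_sub, map_rootForm, map_C]

theorem map_esymmToCraig {k' : Type*} [CommRing k'] (f : k →+* k')
    (p : MvPolynomial (Fin (m + 1)) k) :
    map f (esymmToCraig k d r p) = esymmToCraig k' d (f r) (map f p) := by
  induction p using MvPolynomial.induction_on with
  | C a => simp only [algHom_C, algebraMap_eq, map_C]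
  | add p p' hp hp' => simp only [map_add, hp, hp']
  | mul_X p j hp =>
    rw [map_mul, map_mul, map_mul, map_mul, hp, map_X]
    simp only [esymmToCraig, aeval_X, map_permToCraig, map_esymm]

theorem exists_esymmToCraig [IsDomain k] [CharZero k] (hdq : d * q = m + 2) (hr : q * r = 1)
    {f : MvPolynomial (Fin (m + 1)) k} (hf : f ∈ craigInvariants k m d q) :
    ∃ G, esymmToCraig k d r G = f := by
  let N := Fintype.card (Equiv.Perm (Fin (m + 2)))
  have hN : (N : MvPolynomial (Fin (m + 1)) k) ≠ 0 := Nat.cast_ne_zero.2 Fintype.card_ne_zero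
  have hs : (∑ σ : Equiv.Perm (Fin (m + 2)), rename σ (craigToPerm k q f)).IsSymmetric := fun τ => by
    simp only [map_sum, rename_rename]
    exact Equiv.sum_comp (Equiv.mulLeft τ) fun σ : Equiv.Perm (Fin (m + 2)) =>
      rename σ (craigToPerm k q f)
  obtain ⟨H, hH⟩ := exists_aeval_esymm_of_isSymmetric hs
  have h := permToCraig_aeval_esymm hdq hr H
  rw [hH, map_sum, Finset.sum_congr rfl fun σ _ => (permToCraig_rename hdq hr σ _).trans
    (by rw [permToCraig_craigToPerm hr, mem_craigInvariants.1 hf]), Finset.sum_const,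
    Finset.card_univ, nsmul_eq_mul] at h
  change (N : MvPolynomial (Fin (m + 1)) k) * f = _ at h
  generalize aeval (Fin.cons (α := fun _ => MvPolynomial (Fin (m + 1)) k) 0 X) H = G at h
  let g : k →+* k ⧸ Ideal.span {(N : k)} := Ideal.Quotient.mk _
  have hg (a : k) : g a = 0 ↔ (N : k) ∣ a := by
    rw [Ideal.Quotient.eq_zero_iff_mem, Ideal.mem_span_singleton]
  have hG : map g G = 0 := by
    have hr' : (q : k ⧸ Ideal.span {(N : k)}) * g r = 1 := by
      rw [← map_natCast g, ← map_mul, hr, map_one]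
    refine (injective_iff_map_eq_zero _).1 (esymmToCraig_injective hdq hr') _ ?_
    rw [← map_esymmToCraig, ← h, map_mul, ← map_natCast C, map_C, (hg _).2 dvd_rfl, C_0, zero_mul]
  rw [← C_dvd_iff_map_hom_eq_zero g (N : k) hg, map_natCast] at hG
  obtain ⟨G', rfl⟩ := hG
  refine ⟨G', mul_left_cancel₀ hN ?_⟩
  rw [h, map_mul, map_natCast]

/-- If `n / d` is a unit, then the invariants of `L_d` form a polynomial ring. -/
theorem nonempty_algEquiv_of_mul_eq_one [IsDomain k] [CharZero k] (hdq : d * q = m + 2)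
    (hr : q * r = 1) :
    Nonempty (craigInvariants k m d q ≃ₐ[k] MvPolynomial (Fin (m + 1)) k) := by
  refine ⟨(AlgEquiv.ofBijective ((esymmToCraig k d r).codRestrict (craigInvariants k m d q)
    (esymmToCraig_mem hdq hr)) ⟨?_, ?_⟩).symm⟩
  · exact fun a b hab => esymmToCraig_injective hdq hr (congrArg Subtype.val hab)
  · rintro ⟨f, hf⟩
    obtain ⟨G, hG⟩ := exists_esymmToCraig hdq hr hf
    exact ⟨G, Subtype.ext hG⟩

end Unit

/-! ### The exceptional case: `L_2` for the symmetric group on four letters -/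

section Exceptional

variable {k : Type*} [CommRing k]

theorem esymm_fin_three_two : esymm (Fin 3) k 2 = X 0 * X 1 + X 0 * X 2 + X 1 * X 2 := by
  have h : Finset.powersetCard 2 (Finset.univ : Finset (Fin 3)) = {{0, 1}, {0, 2}, {1, 2}} := by
    decide
  rw [esymm, h, Finset.sum_insert (by decide), Finset.sum_insert (by decide), Finset.sum_singleton,
    Finset.prod_pair (by decide), Finset.prod_pair (by decide), Finset.prod_pair (by decide),
    add_assoc]

theorem esymm_fin_three_three : esymm (Fin 3) k 3 = X 0 * X 1 * X 2 := by
  have h : Finset.powersetCard 3 (Finset.univ : Finset (Fin 3)) = {{0, 1, 2}} := by decide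
  rw [esymm, h, Finset.sum_singleton, Finset.prod_insert (by decide), Finset.prod_pair (by decide),
    mul_assoc]

variable (k)

/-- The change of coordinates after which the symmetric group acts on `L_2` by even signed
permutations. -/
noncomputable def ofSignedCoord : MvPolynomial (Fin 3) k →ₐ[k] MvPolynomial (Fin 3) k :=
  aeval ![X 0 + (X 1 + X 1) + X 2, -X 0 - X 1, -X 0 - X 1 - X 2]

/-- The inverse of `ofSignedCoord`. -/
noncomputable def toSignedCoord : MvPolynomial (Fin 3) k →ₐ[k] MvPolynomial (Fin 3) k :=
  aeval ![-X 0 - X 1 - X 2, X 0 + X 2, X 1 - X 2]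

/-- The parametrization of the invariants of even signed permutations. -/
noncomputable def signedInvariants : MvPolynomial (Fin 3) k →ₐ[k] MvPolynomial (Fin 3) k :=
  aeval ![X 0 ^ 2 + X 1 ^ 2 + X 2 ^ 2,
    X 0 ^ 2 * X 1 ^ 2 + X 0 ^ 2 * X 2 ^ 2 + X 1 ^ 2 * X 2 ^ 2, X 0 * X 1 * X 2]

/-- Squaring the last of three variables. -/
noncomputable def squareLast : MvPolynomial (Fin 3) k →ₐ[k] MvPolynomial (Fin 3) k :=
  aeval ![X 0, X 1, X 2 ^ 2]

variable {k}

theorem forall_fin_three {P : Fin 3 → Prop} (h0 : P 0) (h1 : P 1) (h2 : P 2) (i : Fin 3) : P i := by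
  fin_cases i
  exacts [h0, h1, h2]

theorem signedInvariants_X_zero :
    signedInvariants k (X 0) = X 0 ^ 2 + X 1 ^ 2 + X 2 ^ 2 := by
  simp [signedInvariants]

theorem signedInvariants_X_one : signedInvariants k (X 1) =
    X 0 ^ 2 * X 1 ^ 2 + X 0 ^ 2 * X 2 ^ 2 + X 1 ^ 2 * X 2 ^ 2 := by
  simp [signedInvariants]

theorem signedInvariants_X_two : signedInvariants k (X 2) = X 0 * X 1 * X 2 := by
  simp [signedInvariants]

theorem ofSignedCoord_toSignedCoord (f : MvPolynomial (Fin 3) k) :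
    ofSignedCoord k (toSignedCoord k f) = f := by
  refine DFunLike.congr_fun (algHom_ext (f := (ofSignedCoord k).comp (toSignedCoord k))
    (g := AlgHom.id k _) fun i => ?_) f
  fin_cases i <;> simp [ofSignedCoord, toSignedCoord] <;> ring

theorem toSignedCoord_ofSignedCoord (f : MvPolynomial (Fin 3) k) :
    toSignedCoord k (ofSignedCoord k f) = f := by
  refine DFunLike.congr_fun (algHom_ext (f := (toSignedCoord k).comp (ofSignedCoord k))
    (g := AlgHom.id k _) fun i => ?_) f
  fin_cases i <;> simp [ofSignedCoord, toSignedCoord] <;> ring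

theorem signedInvariants_squareLast (f : MvPolynomial (Fin 3) k) :
    signedInvariants k (squareLast k f) =
      expand 2 (aeval (fun i : Fin 3 => esymm (Fin 3) k (i + 1)) f) := by
  suffices h : (signedInvariants k).comp (squareLast k) =
      (expand 2).comp (aeval fun i : Fin 3 => esymm (Fin 3) k (i + 1)) by
    rw [← AlgHom.comp_apply, h, AlgHom.comp_apply]
  refine algHom_ext fun i => ?_
  rw [AlgHom.comp_apply, AlgHom.comp_apply, aeval_X]
  revert i
  refine forall_fin_three ?_ ?_ ?_
  · rw [Fin.val_zero, zero_add, esymm_one, Fin.sum_univ_three, squareLast, aeval_X,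
      Matrix.cons_val_zero, signedInvariants_X_zero]
    simp
  · rw [Fin.val_one, esymm_fin_three_two, squareLast, aeval_X, Matrix.cons_val_one,
      Matrix.cons_val_zero, signedInvariants_X_one]
    simp
  · have hX : squareLast k (X 2) = X 2 ^ 2 := by simp [squareLast]
    rw [Fin.val_two, esymm_fin_three_three, hX, map_pow, signedInvariants_X_two]
    simp [mul_pow]

theorem exists_squareLast (f : MvPolynomial (Fin 3) k) :
    ∃ g h, f = squareLast k g + X 2 * squareLast k h := by
  induction f using MvPolynomial.induction_on with
  | C a => exact ⟨C a, 0, by simp [squareLast]⟩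
  | add p p' hp hp' =>
    obtain ⟨g, h, rfl⟩ := hp
    obtain ⟨g', h', rfl⟩ := hp'
    exact ⟨g + g', h + h', by simp only [map_add]; ring⟩
  | mul_X p j hp =>
    obtain ⟨g, h, rfl⟩ := hp
    fin_cases j
    · exact ⟨g * X 0, h * X 0, by simp [squareLast]; ring⟩
    · exact ⟨g * X 1, h * X 1, by simp [squareLast]; ring⟩
    · exact ⟨h * X 2, g, by simp [squareLast]; ring⟩

theorem eq_zero_of_expand_add_eq_zero [IsDomain k] [CharZero k] {g h : MvPolynomial (Fin 3) k}
    (H : expand 2 g + X 0 * X 1 * X 2 * expand 2 h = 0) : g = 0 ∧ h = 0 := by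
  let s : MvPolynomial (Fin 3) k →ₐ[k] MvPolynomial (Fin 3) k := aeval ![-X 0, X 1, X 2]
  have hs (p : MvPolynomial (Fin 3) k) : s (expand 2 p) = expand 2 p := by
    refine DFunLike.congr_fun (algHom_ext (f := s.comp (expand 2)) (g := expand 2) fun i => ?_) p
    fin_cases i <;> simp [s]
  have H' := congrArg s H
  simp only [map_add, map_mul, hs, map_zero] at H'
  simp only [s, aeval_X, Matrix.cons_val_zero, Matrix.cons_val_one, Matrix.cons_val] at H'
  have h2 : (2 : MvPolynomial (Fin 3) k) ≠ 0 := two_ne_zero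
  have hg : expand 2 g = 0 := by
    refine (mul_eq_zero.1 ?_).resolve_left h2
    linear_combination H + H'
  have hinj := expand_injective (σ := Fin 3) (R := k) (n := 2) two_pos
  refine ⟨hinj (by rw [hg, map_zero]), hinj ?_⟩
  rw [hg, zero_add, mul_eq_zero] at H
  rw [map_zero]
  exact H.resolve_left (by simp)

theorem signedInvariants_injective [IsDomain k] [CharZero k] :
    Function.Injective (signedInvariants k) := by
  rw [injective_iff_map_eq_zero]
  intro f hf
  obtain ⟨g, h, rfl⟩ := exists_squareLast f
  rw [map_add, map_mul, signedInvariants_squareLast, signedInvariants_squareLast] at hf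
  rw [signedInvariants_X_two] at hf
  obtain ⟨hg, hh⟩ := eq_zero_of_expand_add_eq_zero hf
  rw [aeval_esymm_injective k 3 (hg.trans (map_zero _).symm),
    aeval_esymm_injective k 3 (hh.trans (map_zero _).symm)]
  simp

theorem coeff_aeval_C_mul_X {n : ℕ} (v : Fin n → k) (f : MvPolynomial (Fin n) k)
    (s : Fin n →₀ ℕ) :
    coeff s (aeval (fun i => C (v i) * X i) f) = coeff s f * ∏ i, v i ^ s i := by
  induction f using MvPolynomial.induction_on' with
  | monomial u a =>
    have h : aeval (fun i => C (v i) * X i) (monomial u a) =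
        monomial u (a * ∏ i, v i ^ u i) := by
      rw [aeval_monomial, Finsupp.prod_fintype _ _ (by simp), monomial_eq,
        Finsupp.prod_fintype _ _ (by simp), algebraMap_eq]
      simp only [mul_pow, Finset.prod_mul_distrib, map_mul, map_prod, map_pow, mul_assoc]
    rw [h, coeff_monomial, coeff_monomial]
    split_ifs with hu
    · rw [hu]
    · rw [zero_mul]
  | add p p' hp hp' => rw [map_add, coeff_add, hp, hp', coeff_add, add_mul]

theorem exists_expand_add [IsDomain k] [CharZero k] {f : MvPolynomial (Fin 3) k}
    (h1 : aeval ![X 0, -X 1, -X 2] f = f) (h2 : aeval ![-X 0, -X 1, X 2] f = f) :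
    ∃ g h, f = expand 2 g + X 0 * X 1 * X 2 * expand 2 h := by
  have hne : (-1 : k) ≠ 1 := fun h => two_ne_zero (α := k) (by linear_combination -h)
  have h12 (s : Fin 3 →₀ ℕ) (hs : coeff s f ≠ 0) : Even (s 1 + s 2) := by
    have H := congrArg (coeff s) h1
    have hv : (![X 0, -X 1, -X 2] : Fin 3 → MvPolynomial (Fin 3) k) =
        fun i => C (![1, -1, -1] i) * X i := funext (forall_fin_three (by simp) (by simp) (by simp))
    rw [hv, coeff_aeval_C_mul_X, Fin.prod_univ_three, mul_eq_left₀ hs] at H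
    exact (neg_one_pow_eq_one_iff_even hne).1 (by simpa [← pow_add] using H)
  have h01 (s : Fin 3 →₀ ℕ) (hs : coeff s f ≠ 0) : Even (s 0 + s 1) := by
    have H := congrArg (coeff s) h2
    have hv : (![-X 0, -X 1, X 2] : Fin 3 → MvPolynomial (Fin 3) k) =
        fun i => C (![-1, -1, 1] i) * X i := funext (forall_fin_three (by simp) (by simp) (by simp))
    rw [hv, coeff_aeval_C_mul_X, Fin.prod_univ_three, mul_eq_left₀ hs] at H
    exact (neg_one_pow_eq_one_iff_even hne).1 (by simpa [← pow_add] using H)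
  have hmon (s : Fin 3 →₀ ℕ) : ∃ g h, monomial s (coeff s f) =
      expand 2 g + X 0 * X 1 * X 2 * expand 2 h := by
    by_cases hs : coeff s f = 0
    · exact ⟨0, 0, by simp [hs]⟩
    have e1 := h12 s hs
    have e2 := h01 s hs
    let u : Fin 3 →₀ ℕ := Finsupp.equivFunOnFinite.symm fun i => s i / 2
    rcases Nat.even_or_odd (s 0) with h0 | h0
    · refine ⟨monomial u (coeff s f), 0, ?_⟩
      have hu : s = 2 • u := Finsupp.ext (forall_fin_three
        (by simp [u]; grind) (by simp [u]; grind) (by simp [u]; grind))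
      rw [expand_monomial, map_zero, mul_zero, add_zero, ← hu]
    · refine ⟨0, monomial u (coeff s f), ?_⟩
      have hu : s = Finsupp.single 0 1 + Finsupp.single 1 1 + Finsupp.single 2 1 + 2 • u :=
        Finsupp.ext (forall_fin_three
          (by simp [u]; grind) (by simp [u]; grind) (by simp [u]; grind))
      rw [expand_monomial, map_zero, zero_add]
      simp only [X, monomial_mul, one_mul]
      rw [← hu]
  choose g h hgh using hmon
  refine ⟨∑ s ∈ f.support, g s, ∑ s ∈ f.support, h s, ?_⟩
  conv_lhs => rw [f.as_sum]
  rw [map_sum, map_sum, Finset.mul_sum, ← Finset.sum_add_distrib]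
  exact Finset.sum_congr rfl fun s _ => hgh s

theorem exists_signedInvariants [IsDomain k] [CharZero k] {f : MvPolynomial (Fin 3) k}
    (h1 : aeval ![X 0, -X 1, -X 2] f = f) (h2 : aeval ![-X 0, -X 1, X 2] f = f)
    (hf : f.IsSymmetric) : ∃ g, signedInvariants k g = f := by
  obtain ⟨g, h, rfl⟩ := exists_expand_add h1 h2
  have hs (σ : Equiv.Perm (Fin 3)) : rename σ g - g = 0 ∧ rename σ h - h = 0 := by
    refine eq_zero_of_expand_add_eq_zero ?_
    have H := hf σ
    have hX' : rename σ (X 0 * X 1 * X 2 : MvPolynomial (Fin 3) k) = X 0 * X 1 * X 2 := by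
      rw [← esymm_fin_three_three, rename_esymm]
    rw [map_add, map_mul, rename_expand, rename_expand, hX'] at H
    rw [map_sub, map_sub]
    linear_combination H
  obtain ⟨G, rfl⟩ := exists_aeval_esymm_of_isSymmetric (f := g) fun σ => sub_eq_zero.1 (hs σ).1
  obtain ⟨H, rfl⟩ := exists_aeval_esymm_of_isSymmetric (f := h) fun σ => sub_eq_zero.1 (hs σ).2
  refine ⟨squareLast k G + X 2 * squareLast k H, ?_⟩
  rw [map_add, map_mul, signedInvariants_squareLast, signedInvariants_squareLast,
    signedInvariants_X_two]

theorem craigAct_ofSignedCoord (f : MvPolynomial (Fin 3) k) :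
    craigAct k 2 2 (Equiv.swap 0 1) (ofSignedCoord k f) =
      ofSignedCoord k (aeval ![X 0, -X 2, -X 1] f) ∧
    craigAct k 2 2 (Equiv.swap 1 2) (ofSignedCoord k f) =
      ofSignedCoord k (aeval ![-X 2, X 1, -X 0] f) ∧
    craigAct k 2 2 (Equiv.swap 2 3) (ofSignedCoord k f) =
      ofSignedCoord k (aeval ![X 0, X 2, X 1] f) := by
  have h1 : rootForm k 2 (1 : Fin 4) = 0 := rootForm_one k 2
  have h2 : rootForm k 2 (2 : Fin 4) = -X (1 : Fin 3) := by
    have h := rootForm_sub_rootForm k 2 (0 : Fin 2)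
    change rootForm k 2 (1 : Fin 4) - rootForm k 2 (2 : Fin 4) = X (1 : Fin 3) at h
    linear_combination h1 - h
  have h3 : rootForm k 2 (3 : Fin 4) = -X (1 : Fin 3) - X 2 := by
    have h := rootForm_sub_rootForm k 2 (1 : Fin 2)
    change rootForm k 2 (2 : Fin 4) - rootForm k 2 (3 : Fin 4) = X (2 : Fin 3) at h
    linear_combination h2 - h
  have h0 : rootForm k 2 (0 : Fin 4) = 2 * X (0 : Fin 3) + 2 * X 1 + X 2 := by
    have h := (Fin.sum_univ_four (rootForm k 2 (m := 2))).symm.trans (sum_rootForm k 2)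
    rw [map_natCast] at h
    push_cast at h
    linear_combination h - h1 - h2 - h3
  have a0 (σ : Equiv.Perm (Fin 4)) : craigAct k 2 2 σ (X (0 : Fin 3)) =
      X 0 - 2 * rootForm k 2 (σ 1) := by
    rw [craigAct_X_zero, map_natCast, Nat.cast_ofNat]
  have a1 (σ : Equiv.Perm (Fin 4)) : craigAct k 2 2 σ (X (1 : Fin 3)) =
      rootForm k 2 (σ 1) - rootForm k 2 (σ 2) := craigAct_X_succ k 2 2 σ (0 : Fin 2)
  have a2 (σ : Equiv.Perm (Fin 4)) : craigAct k 2 2 σ (X (2 : Fin 3)) =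
      rootForm k 2 (σ 2) - rootForm k 2 (σ 3) := craigAct_X_succ k 2 2 σ (1 : Fin 2)
  have key (σ : Equiv.Perm (Fin 4)) (v : Fin 3 → MvPolynomial (Fin 3) k)
      (h : ∀ i, craigAct k 2 2 σ (ofSignedCoord k (X i)) = ofSignedCoord k (v i)) :
      craigAct k 2 2 σ (ofSignedCoord k f) = ofSignedCoord k (aeval v f) := by
    refine DFunLike.congr_fun (algHom_ext (f := (craigAct k 2 2 σ).comp (ofSignedCoord k))
      (g := (ofSignedCoord k).comp (aeval v)) fun i => ?_) f
    simp [h i]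
  have b00 : Equiv.swap (0 : Fin 4) 1 1 = 0 := by decide
  have b01 : Equiv.swap (0 : Fin 4) 1 2 = 2 := by decide
  have b02 : Equiv.swap (0 : Fin 4) 1 3 = 3 := by decide
  have b10 : Equiv.swap (1 : Fin 4) 2 1 = 2 := by decide
  have b11 : Equiv.swap (1 : Fin 4) 2 2 = 1 := by decide
  have b12 : Equiv.swap (1 : Fin 4) 2 3 = 3 := by decide
  have b20 : Equiv.swap (2 : Fin 4) 3 1 = 1 := by decide
  have b21 : Equiv.swap (2 : Fin 4) 3 2 = 3 := by decide
  have b22 : Equiv.swap (2 : Fin 4) 3 3 = 2 := by decide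
  refine ⟨key _ _ ?_, key _ _ ?_, key _ _ ?_⟩ <;> refine forall_fin_three ?_ ?_ ?_ <;>
    simp [ofSignedCoord, a0, a1, a2, b00, b01, b02, b10, b11, b12, b20, b21, b22, h0, h1, h2, h3]
    <;> ring

theorem mem_craigInvariants_two_two {f : MvPolynomial (Fin 3) k} :
    f ∈ craigInvariants k 2 2 2 ↔ craigAct k 2 2 (Equiv.swap 0 1) f = f ∧
      craigAct k 2 2 (Equiv.swap 1 2) f = f ∧ craigAct k 2 2 (Equiv.swap 2 3) f = f := by
  rw [mem_craigInvariants]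
  refine ⟨fun h => ⟨h _, h _, h _⟩, fun ⟨h0, h1, h2⟩ σ => ?_⟩
  have hσ : σ ∈ Submonoid.closure (Set.range fun i : Fin 3 => Equiv.swap i.castSucc i.succ) := by
    rw [Equiv.Perm.mclosure_swap_castSucc_succ]
    trivial
  induction hσ using Submonoid.closure_induction with
  | mem σ h =>
    obtain ⟨i, rfl⟩ := h
    fin_cases i
    exacts [h0, h1, h2]
  | one => rw [craigAct_one, AlgHom.id_apply]
  | mul σ τ _ _ hσ hτ => rw [← craigAct_craigAct k σ τ rfl, hτ, hσ]

/-- The invariants of `L_2` for the symmetric group on four letters form a polynomial ring. -/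
theorem nonempty_algEquiv_two_two [IsDomain k] [CharZero k] :
    Nonempty (craigInvariants k 2 2 2 ≃ₐ[k] MvPolynomial (Fin 3) k) := by
  let S : Subalgebra k (MvPolynomial (Fin 3) k) := craigInvariants k 2 2 2
  have hmem (g : MvPolynomial (Fin 3) k) :
      (ofSignedCoord k).comp (signedInvariants k) g ∈ S := by
    obtain ⟨h0, h1, h2⟩ := craigAct_ofSignedCoord (signedInvariants k g)
    have key (v : Fin 3 → MvPolynomial (Fin 3) k)
        (h : ∀ i, aeval v (signedInvariants k (X i)) = signedInvariants k (X i)) :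
        aeval v (signedInvariants k g) = signedInvariants k g :=
      DFunLike.congr_fun (algHom_ext (f := (aeval v).comp (signedInvariants k))
        (g := signedInvariants k) h) g
    rw [AlgHom.comp_apply, mem_craigInvariants_two_two, h0, h1, h2]
    refine ⟨congrArg _ (key _ ?_), congrArg _ (key _ ?_), congrArg _ (key _ ?_)⟩ <;>
      refine forall_fin_three ?_ ?_ ?_ <;>
      simp [signedInvariants_X_zero, signedInvariants_X_one, signedInvariants_X_two] <;> ring
  have hinj : Function.Injective (ofSignedCoord k) :=
    Function.LeftInverse.injective toSignedCoord_ofSignedCoord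
  refine ⟨(AlgEquiv.ofBijective (((ofSignedCoord k).comp (signedInvariants k)).codRestrict
    S hmem) ⟨(AlgHom.injective_codRestrict _ S hmem).2 ?_, ?_⟩).symm⟩
  · rw [AlgHom.coe_comp]
    exact hinj.comp signedInvariants_injective
  · rintro ⟨p, hp⟩
    obtain ⟨f, rfl⟩ : ∃ f, ofSignedCoord k f = p := ⟨_, ofSignedCoord_toSignedCoord p⟩
    obtain ⟨h0, h1, h2⟩ := mem_craigInvariants_two_two.1 hp
    obtain ⟨e0, e1, e2⟩ := craigAct_ofSignedCoord f
    replace h0 := hinj (e0.symm.trans h0)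
    replace h1 := hinj (e1.symm.trans h1)
    replace h2 := hinj (e2.symm.trans h2)
    have comp (u v w : Fin 3 → MvPolynomial (Fin 3) k) (hu : aeval u f = f) (hv : aeval v f = f)
        (h : ∀ i, aeval u (v i) = w i) : aeval w f = f := by
      have H : (aeval u).comp (aeval v) = aeval (R := k) w := algHom_ext fun i => by
        rw [AlgHom.comp_apply, aeval_X, aeval_X, h]
      rw [← H, AlgHom.comp_apply, hv, hu]
    have g0 : aeval ![X 0, -X 1, -X 2] f = f :=
      comp _ _ _ h0 h2 (forall_fin_three (by simp) (by simp) (by simp))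
    have g1 : aeval ![-X 2, -X 1, X 0] f = f :=
      comp _ _ _ h1 g0 (forall_fin_three (by simp) (by simp) (by simp))
    have g2 : aeval ![-X 0, -X 1, X 2] f = f :=
      comp _ _ _ g1 h1 (forall_fin_three (by simp) (by simp) (by simp))
    have g3 : aeval ![-X 0, X 1, -X 2] f = f :=
      comp _ _ _ g2 g0 (forall_fin_three (by simp) (by simp) (by simp))
    have g4 : aeval ![X 2, X 1, X 0] f = f :=
      comp _ _ _ h1 g3 (forall_fin_three (by simp) (by simp) (by simp))
    have g5 : aeval ![X 1, X 2, X 0] f = f :=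
      comp _ _ _ h2 g4 (forall_fin_three (by simp) (by simp) (by simp))
    have g6 : aeval ![X 1, X 0, X 2] f = f :=
      comp _ _ _ g5 h2 (forall_fin_three (by simp) (by simp) (by simp))
    have hsymm : f.IsSymmetric := fun σ => by
      have hσ : σ ∈ Submonoid.closure
          (Set.range fun i : Fin 2 => Equiv.swap i.castSucc i.succ) := by
        rw [Equiv.Perm.mclosure_swap_castSucc_succ]
        trivial
      induction hσ using Submonoid.closure_induction with
      | mem σ h =>
        obtain ⟨i, rfl⟩ := h
        have hr (w : Fin 3 → MvPolynomial (Fin 3) k) (τ : Equiv.Perm (Fin 3))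
            (h : ∀ i, X (τ i) = w i) (hw : aeval w f = f) : rename τ f = f := by
          have : rename τ = aeval (R := k) w := algHom_ext fun i => by
            rw [rename_X, aeval_X, h]
          rw [this, hw]
        fin_cases i
        · exact hr ![X 1, X 0, X 2] _ (forall_fin_three rfl rfl rfl) g6
        · exact hr ![X 0, X 2, X 1] _ (forall_fin_three rfl rfl rfl) h2
      | one => simp
      | mul σ τ _ _ hσ hτ => rw [Equiv.Perm.coe_mul, ← rename_rename, hτ, hσ]
    obtain ⟨g, rfl⟩ := exists_signedInvariants g0 g2 hsymm
    exact ⟨g, rfl⟩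

end Exceptional

/-- let `R` be a ring with `ℤ ⊆ R ⊆ ℚ`, let `n ≥ 3`, let `d > 0` divide `n`,
and let `L_d` be Craig's integral representation of `S_n` of rank `n-1`. Then
`R[L_d]^{S_n}` is isomorphic to a polynomial ring over `R` if and only if `d/n ∈ R`,
except in the single case `n = 4`, `d = 2`, where `ℤ[L_2]^{S_4}` is also a polynomial ring
(`ℤ` is the bottom subring of `ℚ`). -/
theorem craig_invariants_polynomial_iff_general (n d : ℕ) (hn : 3 ≤ n) (hd : d ∣ n)
    (hd0 : 0 < d) (R : Subring ℚ) :
    (¬(n = 4 ∧ d = 2) → (IsPolynomialRingQ R (craigGroup n d) ↔ (d : ℚ) / (n : ℚ) ∈ R)) ∧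
    (n = 4 → d = 2 → IsPolynomialRingQ (⊥ : Subring ℚ) (craigGroup n d)) := by
  obtain ⟨m, rfl⟩ : ∃ m, n = m + 2 := ⟨n - 2, by lia⟩
  obtain ⟨q, hq⟩ := hd
  have hdq : d * q = m + 2 := hq.symm
  have hd' : (d : ℚ) ≠ 0 := Nat.cast_ne_zero.2 hd0.ne'
  have hq0 : q ≠ 0 := by
    rintro rfl
    lia
  refine ⟨fun hex => ?_, fun hm h2 => ?_⟩
  · refine (isPolynomialRingQ_craigGL_iff hd0 hdq R).trans ?_
    have hquot : (d : ℚ) / ((m + 2 : ℕ) : ℚ) = (q : ℚ)⁻¹ := by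
      rw [hq, Nat.cast_mul, div_mul_cancel_left₀ hd']
    rw [hquot]
    constructor
    · rintro ⟨r, hr⟩
      by_contra hqR
      obtain ⟨p, hp, hpq, hpR⟩ := Subring.exists_prime_inv_notMem hq0 hqR
      refine not_nonempty_algEquiv hdq (by lia) hp (Subring.isMaximal_span_prime hp hpR) hpq ?_ r hr
      by_contra! hcon
      obtain ⟨⟨a, rfl⟩, hm⟩ := hcon
      obtain ⟨b, rfl⟩ := hpq
      have hp2 := hp.two_le
      have ha : 1 ≤ a := Nat.pos_of_ne_zero (right_ne_zero_of_mul hd0.ne')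
      have hb : 1 ≤ b := Nat.pos_of_ne_zero (right_ne_zero_of_mul hq0)
      have h4 : 4 ≤ p * p := Nat.mul_self_le_mul_self hp2
      have hab : p * p * (a * b) = m + 2 := by rw [← hdq]; ring
      have hm4 : m + 2 = 4 := by nlinarith [Nat.mul_le_mul_left (p * p) (Nat.mul_le_mul ha hb)]
      have hab1 : a * b = 1 := by nlinarith [Nat.mul_le_mul ha hb]
      obtain rfl : a = 1 := Nat.eq_one_of_mul_eq_one_right hab1
      have hp2' : p = 2 := by nlinarith
      exact hex ⟨hm4, by rw [hp2']⟩
    · intro hqR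
      exact ⟨m + 1, nonempty_algEquiv_of_mul_eq_one (r := (⟨(q : ℚ)⁻¹, hqR⟩ : R)) hdq
        (Subtype.ext (mul_inv_cancel₀ (Nat.cast_ne_zero.2 hq0)))⟩
  · obtain rfl : m = 2 := by lia
    subst h2
    obtain rfl : q = 2 := by lia
    exact (isPolynomialRingQ_craigGL_iff hd0 hdq ⊥).2 ⟨3, nonempty_algEquiv_two_two⟩
end

section
/- Let R be a principal ideal domain with quotient field K, let L/K be a finite field extension, and let S be the integral closure of R in L. Let G ⊆ GL_n(R) be a finite group acting on S[x_1, …, x_n] and on R[x_1, …, x_n] by linear substitution of the variables. If the ring of invariants S[x_1, …, x_n]^G is isomorphic to a polynomial ring over S, then R[x_1, …, x_n]^G is isomorphic to a polynomial ring over R. -/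
set_option synthInstance.maxHeartbeats 1000000
set_option maxHeartbeats 1000000

open MvPolynomial

/-- The algebra endomorphism of `A[x_1, …, x_n]` given by the linear substitution
`x_i ↦ ∑_j M_{i,j} x_j` for a matrix `M` over `A`. -/
noncomputable def matAct {A : Type*} [CommRing A] {n : ℕ} (M : Matrix (Fin n) (Fin n) A) :
    MvPolynomial (Fin n) A →ₐ[A] MvPolynomial (Fin n) A :=
  aeval fun i => ∑ j, C (M i j) * X j

/-- For a subgroup `G ⊆ GL_n(R)` and a base change `φ : R →+* A`, the invariant ring
`A[x_1, …, x_n]^G`: the subalgebra of polynomials fixed by the substitution action of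
every element of `G` (with matrix entries transported along `φ`). -/
noncomputable def invariantsOf {R A : Type*} [CommRing R] [CommRing A] {n : ℕ}
    (φ : R →+* A) (G : Subgroup (GL (Fin n) R)) : Subalgebra A (MvPolynomial (Fin n) A) :=
  ⨅ g ∈ G, AlgHom.equalizer
    (matAct (((g : GL (Fin n) R) : Matrix (Fin n) (Fin n) R).map φ)) (AlgHom.id A _)


theorem exists_linearIndependent_forall_mem_span {R S : Type*} [CommRing R] [IsDomain R]
    [IsPrincipalIdealRing R] [AddCommGroup S] [Module R S] [Module.IsTorsionFree R S]
    {s : Set S} (hs : s.Finite) :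
    ∃ (k : ℕ) (t : Fin k → S), LinearIndependent R t ∧
      ∀ a ∈ s, ∃ c : Fin k → R, a = ∑ i, c i • t i := by
  have := Module.Finite.span_of_finite R hs
  let b := Module.finBasis R (Submodule.span R s)
  refine ⟨_, fun i => (b i : S), b.linearIndependent.map' (Submodule.subtype _) (by simp), ?_⟩
  intro a ha
  refine ⟨b.repr ⟨a, Submodule.subset_span ha⟩, ?_⟩
  simpa only [Submodule.coe_sum, Submodule.coe_smul] using
    congrArg Subtype.val (b.sum_repr ⟨a, Submodule.subset_span ha⟩).symm

section BaseChange

variable {R S σ : Type*} [CommRing R] [CommRing S] [Algebra R S]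

theorem eq_zero_of_sum_smul_map_eq_zero {κ : Type*} [Fintype κ] {t : κ → S}
    (ht : LinearIndependent R t) {p : κ → MvPolynomial σ R}
    (h : ∑ i, t i • map (algebraMap R S) (p i) = 0) (i : κ) : p i = 0 := by
  ext d
  refine Fintype.linearIndependent_iff.1 ht (fun i => coeff d (p i)) ?_ i
  simpa [coeff_sum, coeff_map, Algebra.smul_def, mul_comm] using congrArg (coeff d) h

theorem exists_sum_smul_map [IsDomain R] [IsPrincipalIdealRing R]
    [Module.IsTorsionFree R S] (f : MvPolynomial σ S) :
    ∃ (k : ℕ) (t : Fin k → S) (p : Fin k → MvPolynomial σ R), LinearIndependent R t ∧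
      f = ∑ i, t i • map (algebraMap R S) (p i) := by
  obtain ⟨k, t, ht, h⟩ := exists_linearIndependent_forall_mem_span (R := R)
    (f.support.finite_toSet.image fun d => coeff d f)
  choose! c hc using fun d (hd : d ∈ f.support) => h _ (Set.mem_image_of_mem _ hd)
  refine ⟨k, t, fun i => ∑ d ∈ f.support, monomial d (c d i), ht, ?_⟩
  conv_lhs => rw [f.as_sum]
  simp only [map_sum, map_monomial, Finset.smul_sum]
  rw [Finset.sum_comm]
  refine Finset.sum_congr rfl fun d hd => ?_
  rw [hc d hd, map_sum]
  simp [smul_monomial, Algebra.smul_def (R := R), mul_comm]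

theorem exists_decomposition_of_sum_smul_map_mem_span [IsDomain R] [IsPrincipalIdealRing R]
    [Module.IsTorsionFree R S] {N : Submodule R (MvPolynomial σ R)} {J : Type*} [Fintype J]
    {s : J → S} {v : J → MvPolynomial σ R}
    (h : ∑ j, s j • map (algebraMap R S) (v j) ∈
      Submodule.span S (map (algebraMap R S) '' (N : Set (MvPolynomial σ R)))) :
    ∃ (k : ℕ) (t : Fin k → S) (c : J → Fin k → R),
      (∀ j, s j = ∑ i, c j i • t i) ∧ ∀ i, ∑ j, c j i • v j ∈ N := by
  obtain ⟨n, a, g, hg⟩ := Submodule.mem_span_set'.1 h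
  choose w hwN hw using fun i => (g i).2
  obtain ⟨k, t, ht, hst⟩ := exists_linearIndependent_forall_mem_span (R := R)
    ((Set.finite_range s).union (Set.finite_range a))
  choose c hc using fun j => hst (s j) (Or.inl ⟨j, rfl⟩)
  choose d hd using fun j => hst (a j) (Or.inr ⟨j, rfl⟩)
  refine ⟨k, t, c, hc, fun i => ?_⟩
  have key := eq_zero_of_sum_smul_map_eq_zero (σ := σ) ht
    (p := fun i => ∑ j, c j i • v j - ∑ j, d j i • w j) (by
      simp only [map_sub, map_sum, smul_sub, Finset.sum_sub_distrib, Finset.smul_sum]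
      rw [Finset.sum_comm, sub_eq_zero, Finset.sum_comm (t := Finset.univ (α := Fin n))]
      convert hg.symm using 1
      · refine Finset.sum_congr rfl fun j _ => ?_
        rw [hc j, Finset.sum_smul]
        exact Finset.sum_congr rfl fun i _ => by
          simp [Algebra.smul_def]; ring
      · refine Finset.sum_congr rfl fun j _ => ?_
        rw [hd j, Finset.sum_smul, ← hw j]
        exact Finset.sum_congr rfl fun i _ => by
          simp [Algebra.smul_def]; ring) i
  rw [sub_eq_zero.1 key]
  exact N.sum_mem fun j _ => N.smul_mem _ (hwN j)

theorem mem_of_map_mem_span [IsDomain R] [IsPrincipalIdealRing R] [Module.IsTorsionFree R S]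
    [FaithfulSMul R S] [Algebra.IsIntegral R S]
    {N : Submodule R (MvPolynomial σ R)} {v : MvPolynomial σ R}
    (h : map (algebraMap R S) v ∈
      Submodule.span S (map (algebraMap R S) '' (N : Set (MvPolynomial σ R)))) : v ∈ N := by
  obtain ⟨k, t, c, hc, hN⟩ := exists_decomposition_of_sum_smul_map_mem_span (J := Unit)
    (s := fun _ => (1 : S)) (v := fun _ => v) (N := N) (by simpa using h)
  let I : Ideal R := N.comap (LinearMap.toSpanSingleton R _ v)
  have hI : I = ⊤ := by
    rw [← Ideal.map_eq_top_iff (algebraMap R S) (FaithfulSMul.algebraMap_injective R S)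
      (algebraMap_isIntegral_iff.2 inferInstance), Ideal.eq_top_iff_one, hc ()]
    refine Ideal.sum_mem _ fun i _ => ?_
    rw [Algebra.smul_def]
    refine Ideal.mul_mem_right _ _ (Ideal.mem_map_of_mem _ ?_)
    simpa [I] using hN i
  have : (1 : R) ∈ I := hI ▸ Submodule.mem_top
  simpa [I] using this

end BaseChange

section AugmentationModule

variable {σ A : Type*} [CommRing A]

/-- The elements of a subalgebra of a polynomial ring whose constant coefficient vanishes. -/
noncomputable def augmentationModule (B : Subalgebra A (MvPolynomial σ A)) :
    Submodule A (MvPolynomial σ A) :=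
  Subalgebra.toSubmodule B ⊓ LinearMap.ker (lcoeff A 0)

theorem mem_augmentationModule {B : Subalgebra A (MvPolynomial σ A)} {f : MvPolynomial σ A} :
    f ∈ augmentationModule B ↔ f ∈ B ∧ constantCoeff f = 0 := Iff.rfl

theorem exists_algEquiv_constantCoeff_eq {τ : Type*} {B : Subalgebra A (MvPolynomial σ A)}
    (e : B ≃ₐ[A] MvPolynomial τ A) :
    ∃ e' : B ≃ₐ[A] MvPolynomial τ A,
      ∀ b, constantCoeff (e' b) = constantCoeff (b : MvPolynomial σ A) := by
  let a : τ → A := fun i => constantCoeff (e.symm (X i) : MvPolynomial σ A)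
  let T : MvPolynomial τ A ≃ₐ[A] MvPolynomial τ A :=
    AlgEquiv.ofAlgHom (aeval fun i => X i + C (a i)) (aeval fun i => X i - C (a i))
      (by ext; simp [algHom_C]) (by ext; simp [algHom_C])
  refine ⟨e.trans T, fun b => ?_⟩
  let φ : MvPolynomial τ A →ₐ[A] A := (aeval (0 : σ → A)).comp (B.val.comp e.symm.toAlgHom)
  let ψ : MvPolynomial τ A →ₐ[A] A := (aeval (0 : τ → A)).comp T.toAlgHom
  have : ψ = φ := by
    ext i
    simp [φ, ψ, T, a, constantCoeff_eq]
  have := DFunLike.congr_fun this (e b)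
  simpa [φ, ψ, aeval_zero', aeval_zero] using this

theorem exists_linearMap_ker_eq_mul {τ : Type*} {B : Subalgebra A (MvPolynomial σ A)}
    (e : B ≃ₐ[A] MvPolynomial τ A) :
    ∃ D : B →ₗ[A] (τ → A), ∀ b : B, (b : MvPolynomial σ A) ∈ augmentationModule B →
      (D b = 0 ↔ (b : MvPolynomial σ A) ∈ augmentationModule B * augmentationModule B) := by
  obtain ⟨e, he⟩ := exists_algEquiv_constantCoeff_eq e
  let D : B →ₗ[A] (τ → A) :=
    LinearMap.pi fun i => (lcoeff A 0).comp ((pderiv i).toLinearMap.comp e.toLinearMap)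
  have hD : ∀ b i, D b i = constantCoeff (pderiv i (e b)) := fun b i => rfl
  refine ⟨D, fun b hb => ⟨fun h => ?_, fun h => ?_⟩⟩
  · have hcoeff : ∀ s ∈ (e b).support, ∃ i s', s = Finsupp.single i 1 + s' ∧ s' ≠ 0 := by
      intro s hs
      have hs0 : s ≠ 0 := by
        rintro rfl
        exact mem_support_iff.1 hs ((he b).trans hb.2)
      obtain ⟨i, hi⟩ := Finsupp.ne_iff.1 hs0
      refine ⟨i, s - Finsupp.single i 1, ?_, fun h0 => ?_⟩
      · rw [add_tsub_cancel_of_le]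
        simpa [Nat.one_le_iff_ne_zero] using hi
      · have : s = Finsupp.single i 1 := by
          refine le_antisymm (tsub_eq_zero_iff_le.1 h0) ?_
          simpa [Nat.one_le_iff_ne_zero] using hi
        have h1 := congrFun h i
        rw [hD, constantCoeff_eq, coeff_pderiv] at h1
        simp only [zero_add, Finsupp.coe_zero, Pi.zero_apply, Nat.cast_zero, mul_one] at h1
        exact mem_support_iff.1 hs (this ▸ h1)
    have hb' : (b : MvPolynomial σ A) =
        ∑ s ∈ (e b).support, (e.symm (monomial s (coeff s (e b))) : MvPolynomial σ A) := by
      rw [← AddSubmonoidClass.coe_finsetSum, ← map_sum, ← (e b).as_sum, e.symm_apply_apply]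
    have hmem : ∀ p : MvPolynomial τ A, constantCoeff p = 0 →
        (e.symm p : MvPolynomial σ A) ∈ augmentationModule B := fun p hp =>
      mem_augmentationModule.2 ⟨(e.symm p).2, by rw [← he, e.apply_symm_apply, hp]⟩
    classical
    rw [hb']
    refine Submodule.sum_mem _ fun s hs => ?_
    obtain ⟨i, s', rfl, hs'⟩ := hcoeff s hs
    rw [← one_mul (coeff _ _), ← monomial_mul, map_mul, Subalgebra.coe_mul]
    refine Submodule.mul_mem_mul (hmem _ ?_) (hmem _ ?_)
    · rw [constantCoeff_monomial, if_neg (by simp)]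
    · rw [constantCoeff_monomial, if_neg hs']
  · suffices ∀ f ∈ augmentationModule B * augmentationModule B,
        ∃ hf : f ∈ B, D ⟨f, hf⟩ = 0 from (this b h).2
    intro f hf
    induction hf using Submodule.mul_induction_on' with
    | mem_mul_mem f hf g hg =>
      refine ⟨B.mul_mem hf.1 hg.1, funext fun i => ?_⟩
      have h1 := (he ⟨f, hf.1⟩).trans hf.2
      have h2 := (he ⟨g, hg.1⟩).trans hg.2
      have : (⟨f * g, B.mul_mem hf.1 hg.1⟩ : B) = ⟨f, hf.1⟩ * ⟨g, hg.1⟩ := rfl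
      rw [hD, this, map_mul, Derivation.leibniz]
      simp [h1, h2]
    | add f _ g _ hf hg =>
      obtain ⟨hf, hf'⟩ := hf
      obtain ⟨hg, hg'⟩ := hg
      refine ⟨B.add_mem hf hg, ?_⟩
      have : (⟨f + g, B.add_mem hf hg⟩ : B) = ⟨f, hf⟩ + ⟨g, hg⟩ := rfl
      rw [this, map_add, hf', hg', add_zero]

end AugmentationModule

theorem exists_fin_basis_mod {R V Q : Type*} [CommRing R] [IsDomain R] [IsPrincipalIdealRing R]
    [AddCommGroup V] [Module R V] [AddCommGroup Q] [Module R Q] [Module.IsTorsionFree R Q]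
    {W N : Submodule R V} (hW : W.FG) (D : W →ₗ[R] Q) (hD : ∀ w, D w = 0 ↔ (w : V) ∈ N) :
    ∃ (r : ℕ) (f : Fin r → V), (∀ j, f j ∈ W) ∧
      (∀ c : Fin r → R, ∑ j, c j • f j ∈ N → ∀ j, c j = 0) ∧
      ∀ w ∈ W, ∃ c : Fin r → R, w - ∑ j, c j • f j ∈ N := by
  have := Module.Finite.iff_fg.2 hW
  let b := Module.finBasis R (LinearMap.range D)
  choose f hf using fun j => (b j).2
  refine ⟨_, fun j => f j, fun j => (f j).2, fun c hc => ?_, fun w hw => ?_⟩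
  · refine Fintype.linearIndependent_iff.1 b.linearIndependent c (Subtype.ext ?_)
    have := (hD (∑ j, c j • f j)).2 (by simpa using hc)
    simpa [hf] using this
  · refine ⟨b.repr ⟨D ⟨w, hw⟩, _, rfl⟩, ?_⟩
    have h := congrArg Subtype.val (b.sum_repr ⟨D ⟨w, hw⟩, _, rfl⟩)
    rw [Submodule.coe_sum] at h
    have := (hD (⟨w, hw⟩ - ∑ j, b.repr ⟨D ⟨w, hw⟩, _, rfl⟩ j • f j)).1 (by
      rw [map_sub, map_sum, sub_eq_zero]
      simpa only [map_smul, hf, Submodule.coe_smul] using h.symm)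
    simpa using this

section Graded

variable {σ A : Type*} [CommRing A] {B : Subalgebra A (MvPolynomial σ A)}

theorem homogeneousComponent_mem_augmentationModule
    (hgr : ∀ f ∈ B, ∀ d, homogeneousComponent d f ∈ B) {f : MvPolynomial σ A}
    (hf : f ∈ augmentationModule B) (d : ℕ) :
    homogeneousComponent d f ∈ augmentationModule B := by
  rw [mem_augmentationModule] at *
  refine ⟨hgr f hf.1 d, ?_⟩
  have := hf.2
  rw [constantCoeff_eq] at *
  rw [coeff_homogeneousComponent, this, ite_self]

theorem homogeneousComponent_mem_of_mem_mul
    (hgr : ∀ f ∈ B, ∀ d, homogeneousComponent d f ∈ B) {d : ℕ}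
    {W : Submodule A (MvPolynomial σ A)}
    (hW : ∀ p q, p ≠ 0 → q ≠ 0 → p + q = d →
      ∀ a ∈ augmentationModule B ⊓ homogeneousSubmodule σ A p,
      ∀ b ∈ augmentationModule B ⊓ homogeneousSubmodule σ A q, a * b ∈ W)
    {f : MvPolynomial σ A} (hf : f ∈ augmentationModule B * augmentationModule B) :
    homogeneousComponent d f ∈ W := by
  induction hf using Submodule.mul_induction_on' with
  | mem_mul_mem a ha b hb =>
    rw [← sum_homogeneousComponent a, ← sum_homogeneousComponent b, Finset.sum_mul_sum, map_sum]
    refine Submodule.sum_mem _ fun p _ => ?_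
    rw [map_sum]
    refine Submodule.sum_mem _ fun q _ => ?_
    rw [homogeneousComponent_of_mem (n := p + q) ((homogeneousComponent_isHomogeneous p a).mul
      (homogeneousComponent_isHomogeneous q b))]
    split_ifs with h
    · have hzero : ∀ g ∈ augmentationModule B, homogeneousComponent 0 g = 0 := fun g hg => by
        rw [homogeneousComponent_zero, ← constantCoeff_eq, (mem_augmentationModule.1 hg).2, C_0]
      rcases eq_or_ne p 0 with rfl | hp
      · simp [hzero a ha]
      rcases eq_or_ne q 0 with rfl | hq
      · simp [hzero b hb]
      exact hW p q hp hq h.symm _ ⟨homogeneousComponent_mem_augmentationModule hgr ha p,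
        homogeneousComponent_isHomogeneous p a⟩ _
        ⟨homogeneousComponent_mem_augmentationModule hgr hb q,
        homogeneousComponent_isHomogeneous q b⟩
    · exact W.zero_mem
  | add a _ b _ ha hb => rw [map_add]; exact W.add_mem ha hb

theorem homogeneousComponent_mem_mul_augmentationModule
    (hgr : ∀ f ∈ B, ∀ d, homogeneousComponent d f ∈ B) {f : MvPolynomial σ A}
    (hf : f ∈ augmentationModule B * augmentationModule B) (d : ℕ) :
    homogeneousComponent d f ∈ augmentationModule B * augmentationModule B :=
  homogeneousComponent_mem_of_mem_mul hgr
    (fun _ _ _ _ _ _ ha _ hb => Submodule.mul_mem_mul ha.1 hb.1) hf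

/-- Graded Nakayama lemma: homogeneous elements that span the augmentation module modulo its
square generate the algebra. -/
theorem adjoin_eq_of_forall_sub_mem_mul
    (hgr : ∀ f ∈ B, ∀ d, homogeneousComponent d f ∈ B) {r : ℕ → ℕ}
    {f : ∀ d, Fin (r d) → MvPolynomial σ A}
    (hf : ∀ d j, f d j ∈ augmentationModule B ⊓ homogeneousSubmodule σ A d)
    (hspan : ∀ d, ∀ b ∈ augmentationModule B ⊓ homogeneousSubmodule σ A d,
      ∃ c : Fin (r d) → A, b - ∑ j, c j • f d j ∈ augmentationModule B * augmentationModule B) :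
    Algebra.adjoin A (Set.range fun x : (d : ℕ) × Fin (r d) => f x.1 x.2) = B := by
  set T := Algebra.adjoin A (Set.range fun x : (d : ℕ) × Fin (r d) => f x.1 x.2)
  have hfT : ∀ d j, f d j ∈ T := fun d j => Algebra.subset_adjoin ⟨⟨d, j⟩, rfl⟩
  have hhom : ∀ d, ∀ b ∈ augmentationModule B ⊓ homogeneousSubmodule σ A d, b ∈ T := by
    intro d
    induction d using Nat.strong_induction_on with
    | _ d ih =>
      intro b hb
      obtain ⟨c, hc⟩ := hspan d b hb
      have hsum : ∑ j, c j • f d j ∈ homogeneousSubmodule σ A d :=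
        Submodule.sum_mem _ fun j _ => Submodule.smul_mem _ _ (hf d j).2
      have h1 : homogeneousComponent d (b - ∑ j, c j • f d j) ∈ Subalgebra.toSubmodule T :=
        homogeneousComponent_mem_of_mem_mul hgr (fun p q hp hq hpq a ha b hb =>
          T.mul_mem (ih p (by omega) a ha) (ih q (by omega) b hb)) hc
      rw [homogeneousComponent_of_mem (Submodule.sub_mem _ hb.2 hsum), if_pos rfl] at h1
      have h2 : ∑ j, c j • f d j ∈ T := T.sum_mem fun j _ => T.smul_mem (hfT d j) _
      simpa using T.add_mem h1 h2
  refine le_antisymm (Algebra.adjoin_le ?_) fun b hb => ?_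
  · rintro _ ⟨x, rfl⟩
    exact (hf x.1 x.2).1.1
  · have h : b - C (constantCoeff b) ∈ augmentationModule B :=
      mem_augmentationModule.2 ⟨B.sub_mem hb (B.algebraMap_mem _), by simp⟩
    have h' : b - C (constantCoeff b) ∈ T := by
      rw [← sum_homogeneousComponent (b - C (constantCoeff b))]
      exact T.sum_mem fun d _ => hhom d _ ⟨homogeneousComponent_mem_augmentationModule hgr h d,
        homogeneousComponent_isHomogeneous d _⟩
    simpa using T.add_mem h' (T.algebraMap_mem (constantCoeff b))

theorem eq_zero_of_sum_smul_mem_mul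
    (hgr : ∀ f ∈ B, ∀ d, homogeneousComponent d f ∈ B) {r : ℕ → ℕ}
    {f : ∀ d, Fin (r d) → MvPolynomial σ A}
    (hf : ∀ d j, f d j ∈ augmentationModule B ⊓ homogeneousSubmodule σ A d)
    (hind : ∀ d, ∀ c : Fin (r d) → A,
      ∑ j, c j • f d j ∈ augmentationModule B * augmentationModule B → ∀ j, c j = 0)
    (s : Finset ((d : ℕ) × Fin (r d))) (c : (d : ℕ) × Fin (r d) → A)
    (hc : ∑ x ∈ s, c x • f x.1 x.2 ∈ augmentationModule B * augmentationModule B)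
    (x : (d : ℕ) × Fin (r d)) (hx : x ∈ s) : c x = 0 := by
  classical
  obtain ⟨d, j⟩ := x
  have h := homogeneousComponent_mem_mul_augmentationModule hgr hc d
  have := hind d (fun j => if (⟨d, j⟩ : (d : ℕ) × Fin (r d)) ∈ s then c ⟨d, j⟩ else 0) (by
    convert h using 1
    have hs : s.filter (fun y => y.1 = d) =
        (Finset.univ.filter fun j => (⟨d, j⟩ : (d : ℕ) × Fin (r d)) ∈ s).map
          ⟨Sigma.mk d, sigma_mk_injective⟩ := by
      ext ⟨e, i⟩
      simp only [Finset.mem_filter, Finset.mem_map, Finset.mem_univ, true_and,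
        Function.Embedding.coeFn_mk]
      constructor
      · rintro ⟨hi, rfl⟩
        exact ⟨i, hi, rfl⟩
      · rintro ⟨i', hi', heq⟩
        cases heq
        exact ⟨hi', rfl⟩
    have h1 : ∀ y : (d : ℕ) × Fin (r d), homogeneousComponent d (c y • f y.1 y.2) =
        if y.1 = d then c y • f y.1 y.2 else 0 := fun y => by
      rw [homogeneousComponent_of_mem (Submodule.smul_mem _ _ (hf y.1 y.2).2)]
      exact if_congr eq_comm rfl rfl
    rw [map_sum, Finset.sum_congr rfl fun y _ => h1 y, ← Finset.sum_filter, hs, Finset.sum_map]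
    simp only [ite_smul, zero_smul, ← Finset.sum_filter]
    rfl) j
  simpa [hx] using this

end Graded

section Descent

variable {R S σ : Type*} [CommRing R] [CommRing S] [Algebra R S]
  {B : Subalgebra R (MvPolynomial σ R)} {B' : Subalgebra S (MvPolynomial σ S)}

theorem map_mem_augmentationModule (hmap : ∀ f ∈ B, map (algebraMap R S) f ∈ B')
    {f : MvPolynomial σ R} (hf : f ∈ augmentationModule B) :
    map (algebraMap R S) f ∈ augmentationModule B' :=
  mem_augmentationModule.2 ⟨hmap f hf.1, by
    rw [constantCoeff_map, (mem_augmentationModule.1 hf).2, map_zero]⟩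

theorem map_mem_mul_augmentationModule (hmap : ∀ f ∈ B, map (algebraMap R S) f ∈ B')
    {f : MvPolynomial σ R} (hf : f ∈ augmentationModule B * augmentationModule B) :
    map (algebraMap R S) f ∈ augmentationModule B' * augmentationModule B' := by
  induction hf using Submodule.mul_induction_on' with
  | mem_mul_mem a ha b hb =>
    rw [map_mul]
    exact Submodule.mul_mem_mul (map_mem_augmentationModule hmap ha)
      (map_mem_augmentationModule hmap hb)
  | add a _ b _ ha hb => rw [map_add]; exact Submodule.add_mem _ ha hb

theorem augmentationModule_le_span
    (hspan : ∀ f ∈ B', f ∈ Submodule.span S (map (algebraMap R S) '' (B : Set _))) :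
    augmentationModule B' ≤
      Submodule.span S (map (algebraMap R S) '' (augmentationModule B : Set _)) := by
  intro f hf
  suffices h : ∀ g ∈ Submodule.span S (map (algebraMap R S) '' (B : Set (MvPolynomial σ R))),
      g - C (constantCoeff g) ∈
        Submodule.span S (map (algebraMap R S) '' (augmentationModule B : Set _)) by
    simpa [(mem_augmentationModule.1 hf).2] using h f (hspan f hf.1)
  intro g hg
  induction hg using Submodule.span_induction with
  | mem g hg =>
    obtain ⟨b, hb, rfl⟩ := hg
    refine Submodule.subset_span ⟨b - C (constantCoeff b), mem_augmentationModule.2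
      ⟨B.sub_mem hb (B.algebraMap_mem _), by simp⟩, by simp [constantCoeff_map]⟩
  | zero => simp
  | add x y _ _ hx hy =>
    convert Submodule.add_mem _ hx hy using 1
    simp only [map_add]; ring
  | smul a x _ hx =>
    convert Submodule.smul_mem _ a hx using 1
    simp [smul_eq_C_mul, mul_sub]

theorem mul_augmentationModule_le_span
    (hspan : ∀ f ∈ B', f ∈ Submodule.span S (map (algebraMap R S) '' (B : Set _))) :
    augmentationModule B' * augmentationModule B' ≤ Submodule.span S (map (algebraMap R S) ''
      ((augmentationModule B * augmentationModule B : Submodule R (MvPolynomial σ R)) :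
        Set (MvPolynomial σ R))) := by
  refine (mul_le_mul' (augmentationModule_le_span hspan)
    (augmentationModule_le_span hspan)).trans ?_
  rw [Submodule.span_mul_span, Submodule.span_le]
  rintro _ ⟨_, ⟨a, ha, rfl⟩, _, ⟨b, hb, rfl⟩, rfl⟩
  exact Submodule.subset_span ⟨a * b, Submodule.mul_mem_mul ha hb, by simp⟩

theorem le_adjoin_range_map {J : Type*} {f : J → MvPolynomial σ R}
    (hspan : ∀ g ∈ B', g ∈ Submodule.span S (map (algebraMap R S) '' (B : Set _)))
    (hf : Algebra.adjoin R (Set.range f) = B) :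
    B' ≤ Algebra.adjoin S (Set.range fun j => map (algebraMap R S) (f j)) := by
  intro g hg
  have hle : Submodule.span S (map (algebraMap R S) '' (B : Set (MvPolynomial σ R))) ≤
      Subalgebra.toSubmodule
        (Algebra.adjoin S (Set.range fun j => map (algebraMap R S) (f j))) := by
    rw [Submodule.span_le]
    rintro _ ⟨b, hb, rfl⟩
    rw [← hf] at hb
    change map (algebraMap R S) b ∈
      Algebra.adjoin S (Set.range fun j => map (algebraMap R S) (f j))
    induction hb using Algebra.adjoin_induction with
    | mem x hx =>
      obtain ⟨j, rfl⟩ := hx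
      exact Algebra.subset_adjoin ⟨j, rfl⟩
    | algebraMap a =>
      rw [algebraMap_eq, map_C]
      exact Subalgebra.algebraMap_mem _ _
    | add x y _ _ hx hy => rw [map_add]; exact add_mem hx hy
    | mul x y _ _ hx hy => rw [map_mul]; exact mul_mem hx hy
  exact hle (hspan g hg)

theorem algebraicIndependent_of_adjoin_eq [IsDomain S] {m : ℕ} {J : Type*} [Finite J]
    (hJ : Nat.card J ≤ m) (e : B' ≃ₐ[S] MvPolynomial (Fin m) S) {f : J → MvPolynomial σ S}
    (hf : Algebra.adjoin S (Set.range f) = B') : AlgebraicIndependent S f := by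
  have hmem : ∀ j, f j ∈ B' := fun j => hf ▸ Algebra.subset_adjoin ⟨j, rfl⟩
  let x : J → B' := fun j => ⟨f j, hmem j⟩
  have hx : Algebra.adjoin S (Set.range x) = ⊤ := by
    apply Subalgebra.map_injective (f := B'.val) Subtype.val_injective
    rw [AlgHom.map_adjoin, ← Set.range_comp, Algebra.map_top, Subalgebra.range_val]
    exact hf
  have : Algebra.IsAlgebraic (Algebra.adjoin S (Set.range x)) B' :=
    ⟨fun b => isAlgebraic_algebraMap (⟨b, hx ▸ Algebra.mem_top⟩ :
      Algebra.adjoin S (Set.range x))⟩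
  have hb : IsTranscendenceBasis S x := by
    refine Algebra.IsAlgebraic.isTranscendenceBasis_of_lift_le_trdeg_of_finite S x ?_
    have h : Algebra.trdeg S B' = m := by
      simpa [trdeg_of_isDomain] using e.lift_trdeg_eq
    rw [h, ← Nat.cast_card]
    simpa using hJ
  exact hb.1.map' (f := B'.val) Subtype.val_injective

/-- A graded subalgebra of a polynomial ring over a principal ideal domain `R` that becomes a
polynomial ring after base change to a torsion-free integral extension of `R` is itself a
polynomial ring. -/
theorem exists_algEquiv_mvPolynomial_of_baseChange [IsDomain R] [IsPrincipalIdealRing R]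
    [IsDomain S] [Module.IsTorsionFree R S] [FaithfulSMul R S] [Algebra.IsIntegral R S]
    [Finite σ] (hgr : ∀ f ∈ B, ∀ d, homogeneousComponent d f ∈ B)
    (hmap : ∀ f ∈ B, map (algebraMap R S) f ∈ B')
    (hspan : ∀ f ∈ B', f ∈ Submodule.span S (map (algebraMap R S) '' (B : Set _))) {m : ℕ}
    (e : B' ≃ₐ[S] MvPolynomial (Fin m) S) :
    ∃ k : ℕ, Nonempty (B ≃ₐ[R] MvPolynomial (Fin k) R) := by
  obtain ⟨D, hD⟩ := exists_linearMap_ker_eq_mul e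
  have hP := fun b => map_mem_augmentationModule (f := b) hmap
  let δ : augmentationModule B →ₗ[R] (Fin m → S) :=
    { toFun := fun b => D ⟨map (algebraMap R S) b, hmap _ b.2.1⟩
      map_add' := fun a b => by
        rw [← map_add]; congr 1; ext1; simp
      map_smul' := fun r b => by
        rw [RingHom.id_apply, ← algebraMap_smul S r (D _), ← map_smul]; congr 1; ext1
        simp [Algebra.smul_def (R := R), MvPolynomial.algebraMap_apply] }
  have hδ : ∀ b, δ b = 0 ↔ (b : MvPolynomial σ R) ∈
      augmentationModule B * augmentationModule B := fun b =>
    (hD _ (hP b b.2)).trans ⟨fun h => mem_of_map_mem_span (mul_augmentationModule_le_span hspan h),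
      map_mem_mul_augmentationModule hmap⟩
  have hW : ∀ d, (augmentationModule B ⊓ homogeneousSubmodule σ R d).FG := fun d =>
    Submodule.FG.of_le (homogeneousSubmodule_fg σ R d) inf_le_right
  choose r f hf hind hgen using fun d => exists_fin_basis_mod (hW d)
    (δ.comp (Submodule.inclusion inf_le_left)) (fun w => hδ _)
  have hadj := adjoin_eq_of_forall_sub_mem_mul hgr hf hgen
  have hli : LinearIndependent S fun x : (d : ℕ) × Fin (r d) =>
      D ⟨map (algebraMap R S) (f x.1 x.2), hmap _ (hf x.1 x.2).1.1⟩ := by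
    rw [linearIndependent_iff']
    intro s g hg x hx
    have h1 : ∑ x ∈ s, g x • map (algebraMap R S) (f x.1 x.2) ∈
        augmentationModule B' * augmentationModule B' := by
      have h2 : ∑ x ∈ s, g x • map (algebraMap R S) (f x.1 x.2) ∈ augmentationModule B' :=
        Submodule.sum_mem _ fun x _ => Submodule.smul_mem _ _ (hP _ (hf x.1 x.2).1)
      refine (hD ⟨_, h2.1⟩ h2).1 ?_
      rw [← hg]
      simp only [← map_smul, ← map_sum]
      congr 1
      ext1
      simp
    rw [← Finset.sum_coe_sort] at h1
    obtain ⟨k, t, c, hc, hN⟩ := exists_decomposition_of_sum_smul_map_mem_span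
      (s := fun x : s => g x) (v := fun x : s => f x.1.1 x.1.2)
      (mul_augmentationModule_le_span hspan h1)
    classical
    have h0 : ∀ i, c ⟨x, hx⟩ i = 0 := fun i => by
      have := eq_zero_of_sum_smul_mem_mul hgr hf hind s
        (fun y => if hy : y ∈ s then c ⟨y, hy⟩ i else 0) (by
          rw [← Finset.sum_coe_sort]
          simpa using hN i) x hx
      simpa [hx] using this
    simpa [h0] using hc ⟨x, hx⟩
  have := hli.finite
  have := Fintype.ofFinite ((d : ℕ) × Fin (r d))
  have hcard : Nat.card ((d : ℕ) × Fin (r d)) ≤ m := by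
    simpa using hli.fintype_card_le_finrank
  have hadj' : Algebra.adjoin S (Set.range fun x : (d : ℕ) × Fin (r d) =>
      map (algebraMap R S) (f x.1 x.2)) = B' := by
    refine le_antisymm (Algebra.adjoin_le ?_) (le_adjoin_range_map hspan hadj)
    rintro _ ⟨x, rfl⟩
    exact hmap _ (hf x.1 x.2).1.1
  have hai : AlgebraicIndependent R fun x : (d : ℕ) × Fin (r d) => f x.1 x.2 :=
    (algebraicIndependent_of_adjoin_eq hcard e hadj').of_ringHom_of_comp_eq
      (algebraMap R S) (map (algebraMap R S)) (FaithfulSMul.algebraMap_injective R S)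
      (by ext; simp)
  exact ⟨_, ⟨((renameEquiv R (Finite.equivFin _)).symm.trans
    (hai.aevalEquiv.trans (Subalgebra.equivOfEq _ _ hadj))).symm⟩⟩

end Descent

section Invariants

variable {R A : Type*} [CommRing R] [CommRing A] {n : ℕ}

theorem mem_invariantsOf {φ : R →+* A} {G : Subgroup (GL (Fin n) R)}
    {f : MvPolynomial (Fin n) A} :
    f ∈ invariantsOf φ G ↔
      ∀ g ∈ G, matAct ((g : Matrix (Fin n) (Fin n) R).map φ) f = f := by
  simp [invariantsOf, Algebra.mem_iInf, AlgHom.mem_equalizer]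

theorem matAct_homogeneousComponent (M : Matrix (Fin n) (Fin n) A)
    (f : MvPolynomial (Fin n) A) (d : ℕ) :
    matAct M (homogeneousComponent d f) = homogeneousComponent d (matAct M f) := by
  have hhom : ∀ e, (matAct M (homogeneousComponent e f)).IsHomogeneous e := fun e => by
    have := (homogeneousComponent_isHomogeneous e f).aeval (n := 1)
      (fun i => ∑ j, C (M i j) * X j : Fin n → MvPolynomial (Fin n) A)
      fun i => IsHomogeneous.sum _ _ _ fun j _ => isHomogeneous_C_mul_X _ _
    rwa [one_mul] at this
  conv_rhs => rw [← sum_homogeneousComponent f, map_sum, map_sum]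
  rw [Finset.sum_congr rfl fun e _ => homogeneousComponent_of_mem (m := d) (hhom e),
    Finset.sum_ite_eq]
  split_ifs with h
  · rfl
  · rw [homogeneousComponent_eq_zero d f (by simpa using h), map_zero]

theorem homogeneousComponent_mem_invariantsOf {φ : R →+* A} {G : Subgroup (GL (Fin n) R)}
    {f : MvPolynomial (Fin n) A} (hf : f ∈ invariantsOf φ G) (d : ℕ) :
    homogeneousComponent d f ∈ invariantsOf φ G :=
  mem_invariantsOf.2 fun g hg => by
    rw [matAct_homogeneousComponent, mem_invariantsOf.1 hf g hg]

theorem matAct_map (φ : R →+* A) (M : Matrix (Fin n) (Fin n) R) (f : MvPolynomial (Fin n) R) :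
    matAct (M.map φ) (map φ f) = map φ (matAct (M.map (RingHom.id R)) f) := by
  suffices h : (matAct (M.map φ)).toRingHom.comp (map φ) =
      (map φ).comp (matAct (M.map (RingHom.id R))).toRingHom from DFunLike.congr_fun h f
  ext i
  · simp
  · simp [matAct]

theorem map_mem_invariantsOf {φ : R →+* A} {G : Subgroup (GL (Fin n) R)}
    {f : MvPolynomial (Fin n) R} (hf : f ∈ invariantsOf (RingHom.id R) G) :
    map φ f ∈ invariantsOf φ G :=
  mem_invariantsOf.2 fun g hg => by rw [matAct_map, mem_invariantsOf.1 hf g hg]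

theorem mem_span_map_invariantsOf [Algebra R A] [IsDomain R] [IsPrincipalIdealRing R]
    [Module.IsTorsionFree R A] {G : Subgroup (GL (Fin n) R)} {f : MvPolynomial (Fin n) A}
    (hf : f ∈ invariantsOf (algebraMap R A) G) :
    f ∈ Submodule.span A (map (algebraMap R A) '' (invariantsOf (RingHom.id R) G : Set _)) := by
  obtain ⟨k, t, p, ht, rfl⟩ := exists_sum_smul_map (R := R) f
  refine Submodule.sum_mem _ fun i _ =>
    Submodule.smul_mem _ _ (Submodule.subset_span ⟨p i, ?_, rfl⟩)
  refine mem_invariantsOf.2 fun g hg => sub_eq_zero.1 ?_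
  refine eq_zero_of_sum_smul_map_eq_zero ht (p := fun i =>
    matAct ((g : Matrix (Fin n) (Fin n) R).map (RingHom.id R)) (p i) - p i) ?_ i
  have h := mem_invariantsOf.1 hf g hg
  simp only [map_sum, map_smul, matAct_map] at h
  simp only [map_sub, smul_sub, Finset.sum_sub_distrib, h, sub_self]

end Invariants

/-- let `R` be a principal ideal domain with quotient field `K`, let `L/K`
be a finite field extension, let `S` be the integral closure of `R` in `L`, and let
`G ⊆ GL_n(R)` be a finite group acting on `S[x_1, …, x_n]` and `R[x_1, …, x_n]` by linear
substitution of the variables.  If `S[x_1, …, x_n]^G` is isomorphic to a polynomial ring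
over `S`, then `R[x_1, …, x_n]^G` is isomorphic to a polynomial ring over `R`. -/
theorem invariants_polynomial_descends
    {R : Type*} [CommRing R] [IsDomain R] [IsPrincipalIdealRing R]
    {K : Type*} [Field K] [Algebra R K] [IsFractionRing R K]
    {L : Type*} [Field L] [Algebra K L] [FiniteDimensional K L]
    [Algebra R L] [IsScalarTower R K L]
    {n : ℕ} (G : Subgroup (GL (Fin n) R)) [Finite G]
    (hS : ∃ m : ℕ, Nonempty
      (↥(invariantsOf (algebraMap R ↥(integralClosure R L)) G) ≃ₐ[↥(integralClosure R L)]
        MvPolynomial (Fin m) ↥(integralClosure R L))) :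
    ∃ m : ℕ, Nonempty (↥(invariantsOf (RingHom.id R) G) ≃ₐ[R] MvPolynomial (Fin m) R) := by
  obtain ⟨m, ⟨e⟩⟩ := hS
  have hinj : Function.Injective (algebraMap R L) := by
    rw [IsScalarTower.algebraMap_eq R K L]
    exact (algebraMap K L).injective.comp (IsFractionRing.injective R K)
  have : FaithfulSMul R L := (faithfulSMul_iff_algebraMap_injective R L).2 hinj
  exact exists_algEquiv_mvPolynomial_of_baseChange
    (fun _ hf => homogeneousComponent_mem_invariantsOf hf)
    (fun _ hf => map_mem_invariantsOf hf) (fun _ hf => mem_span_map_invariantsOf hf) e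
end
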